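/- arXiv:2410.11515 — 2 statements merged into one kernel-verified Lean document; each statement's English description precedes it below -/
import Mathlib

section
/- Fix α with 1 < α < 3/2, c > 0 with 1 ≤ (c·2^{2−α})^{1/2}, β > 0, and h > 0, and let the random fields be i.i.d. standard Gaussian. Then the long-range order parameter satisfies m² ≥ 1 − (1/c)·2^α/(2² − 2^α) − h·[ (2−α)·2^{1/2+α}/(2^{3/2} − 2^α)² · log 2 + 2^α/(2^{3/2} − 2^α) · log(2·c^{1/2}·(1 + √(2πe))) ] − (1/β)·[ 2^α/(2² − 2^α) · log(2·c^{1/2}) + (2−α)·2^{1+α}/(2² − 2^α)² · log 2 ]. -/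
open MeasureTheory ProbabilityTheory Filter
open scoped Classical

noncomputable section

/-- The spin value (±1) of a Boolean configuration entry. -/
def spin (b : Bool) : ℝ := if b then 1 else -1

/-- The total spin `S_{n,1} = Σ_i σ_i` of a configuration of `2^n` spins. -/
def totalSpin (n : ℕ) (σ : Fin (2^n) → Bool) : ℝ := ∑ i, spin (σ i)

/-- The Dyson hierarchical Hamiltonian `H_N`, defined recursively:
`H_0 = 0`, `H_{N}(σ) = H_{N-1}(σ₁) + H_{N-1}(σ₂) - 2^{-αN} Σ_{i,j} σ_i σ_j`. -/
def dysonH (α : ℝ) : (N : ℕ) → (Fin (2^N) → Bool) → ℝ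
  | 0, _ => 0
  | (N+1), σ =>
      dysonH α N (fun i => σ ⟨i.1, by have := i.2; rw [pow_succ]; omega⟩)
    + dysonH α N (fun i => σ ⟨2^N + i.1, by have := i.2; rw [pow_succ]; omega⟩)
    - (2:ℝ) ^ (-(α * ((N:ℝ)+1))) *
        ∑ i : Fin (2^(N+1)), ∑ j : Fin (2^(N+1)), spin (σ i) * spin (σ j)

/-- The random-field Hamiltonian `H_N^{RF}(σ) = H_N(σ) - h Σ_i h_i σ_i`,
where `fh` is the field strength and `η` the realization of the random fields. -/
def dysonHRF (α fh : ℝ) (N : ℕ) (η : Fin (2^N) → ℝ) (σ : Fin (2^N) → Bool) : ℝ :=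
  dysonH α N σ - fh * ∑ i, η i * spin (σ i)

/-- The Gibbs average `⟨F⟩_N` with weight `exp(-β H_N^{RF}(σ))`. -/
def gibbs (α β fh : ℝ) (N : ℕ) (η : Fin (2^N) → ℝ) (F : (Fin (2^N) → Bool) → ℝ) : ℝ :=
  (∑ σ, F σ * Real.exp (-β * dysonHRF α fh N η σ)) /
    ∑ σ, Real.exp (-β * dysonHRF α fh N η σ)

/-- The law of `n` i.i.d. standard Gaussian random fields. -/
def gaussianFields (n : ℕ) : Measure (Fin n → ℝ) :=
  Measure.pi fun _ => gaussianReal 0 1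

/-- Expectation with respect to `n` i.i.d. symmetric Bernoulli (±1) random fields,
i.e. the uniform average over `{-1,+1}^n`. -/
def bernoulliExp (n : ℕ) (F : (Fin n → ℝ) → ℝ) : ℝ :=
  ((2:ℝ)^n)⁻¹ * ∑ ε : Fin n → Bool, F (fun i => spin (ε i))

/-- `f_N = 2^{-2N} E[⟨S_{N,1}²⟩_N]` with i.i.d. standard Gaussian random fields. -/
def fG (α β fh : ℝ) (N : ℕ) : ℝ :=
  ((2:ℝ)^(2*N))⁻¹ *
    ∫ η, gibbs α β fh N η (fun σ => (totalSpin N σ)^2) ∂ gaussianFields (2^N)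

/-- `f_N = 2^{-2N} E[⟨S_{N,1}²⟩_N]` with i.i.d. symmetric Bernoulli random fields. -/
def fB (α β fh : ℝ) (N : ℕ) : ℝ :=
  ((2:ℝ)^(2*N))⁻¹ *
    bernoulliExp (2^N) (fun η => gibbs α β fh N η (fun σ => (totalSpin N σ)^2))

/-- `b_n = 2^{(2-α)n}`. -/
def bcoef (α : ℝ) (n : ℕ) : ℝ := (2:ℝ) ^ (((2:ℝ) - α) * n)

/-- The first half `(h_1, …, h_{2^{N-1}})` of the random fields. -/
def half1 (N : ℕ) (η : Fin (2^N) → ℝ) : Fin (2^(N-1)) → ℝ :=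
  fun i => η ⟨i.1, lt_of_lt_of_le i.2 (Nat.pow_le_pow_right (by norm_num) (Nat.sub_le N 1))⟩

/-- The second half `(h_{2^{N-1}+1}, …, h_{2^N})` of the random fields. -/
def half2 (N : ℕ) (η : Fin (2^N) → ℝ) : Fin (2^(N-1)) → ℝ :=
  fun i => if hlt : 2^(N-1) + i.1 < 2^N then η ⟨2^(N-1) + i.1, hlt⟩ else 0

/-- Membership in the `k`-th of the `r` equal subintervals `I_k` of `[-2^{N-1}, 2^{N-1}]`. -/
def inBlock (N r k : ℕ) (x : ℝ) : Prop :=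
  -(2:ℝ)^(N-1) + ((k:ℝ)-1) * ((2:ℝ)^N / r) ≤ x ∧
    x ≤ -(2:ℝ)^(N-1) + (k:ℝ) * ((2:ℝ)^N / r)

/-- The restricted partition function
`Z_k(η) = Σ_{σ : S_{N-1} ∈ I_k} exp(-β H_{N-1}^{RF}(σ) + 2β b_N 2^{-2N} S_{N-1}²)`,
on `2^{N-1}` spins with fields `η`. Both `Z_{k,1}` and `Z_{k,2}` are this function,
applied to the first resp. second half of the random fields. -/
def Zres (α β fh : ℝ) (N r k : ℕ) (η : Fin (2^(N-1)) → ℝ) : ℝ :=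
  ∑ σ : Fin (2^(N-1)) → Bool,
    if inBlock N r k (totalSpin (N-1) σ) then
      Real.exp (-β * dysonHRF α fh (N-1) η σ
        + 2 * β * bcoef α N * ((2:ℝ)^(2*N))⁻¹ * (totalSpin (N-1) σ)^2)
    else 0

/-- `g_k = log (Z_{k,1}(h₁) / Z_{k,2}(h₂))` as a function of all the random fields. -/
def gk (α β fh : ℝ) (N r k : ℕ) (η : Fin (2^N) → ℝ) : ℝ :=
  Real.log (Zres α β fh N r k (half1 N η) / Zres α β fh N r k (half2 N η))

/-- `max_{1 ≤ k ≤ r} g_k`. -/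
def maxgk (α β fh : ℝ) (N r : ℕ) (hr : 1 ≤ r) (η : Fin (2^N) → ℝ) : ℝ :=
  (Finset.Icc 1 r).sup' (Finset.nonempty_Icc.mpr hr) (fun k => gk α β fh N r k η)

/-- The sum of the spins in the `B`-th consecutive block of size `2^n` (out of `2^{N-n}`). -/
def blockSum (N n : ℕ) (σ : Fin (2^N) → Bool) (B : Fin (2^(N-n))) : ℝ :=
  ∑ j : Fin (2^n), if hlt : B.1 * 2^n + j.1 < 2^N then spin (σ ⟨B.1 * 2^n + j.1, hlt⟩) else 0

/-- The generalized pressure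
`P_N(v_N, …, v_1) = log Σ_σ exp(Σ_{n=1}^N v_n Σ_B (Σ_{i∈B} σ_i)² + β h Σ_i h_i σ_i)`
for a given realization `η` of the random fields; the quenched pressure is its
expectation over the fields. -/
def pressure (β fh : ℝ) (N : ℕ) (v : ℕ → ℝ) (η : Fin (2^N) → ℝ) : ℝ :=
  Real.log (∑ σ : Fin (2^N) → Bool,
    Real.exp ((∑ n ∈ Finset.Icc 1 N, v n * ∑ B : Fin (2^(N-n)), (blockSum N n σ B)^2)
      + β * fh * ∑ i, η i * spin (σ i)))

/-- The couplings `v_n = β b_n 2^{-2n}` corresponding to `-β H_N`. -/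
def vcoup (α β : ℝ) (n : ℕ) : ℝ := β * bcoef α n * ((2:ℝ)^(2*n))⁻¹

/-- `f_N = 2^{-2N} ⟨S_{N,1}²⟩_N` without random field. -/
def fNoField (α β : ℝ) (N : ℕ) : ℝ :=
  ((2:ℝ)^(2*N))⁻¹ * gibbs α β 0 N (fun _ => 0) (fun σ => (totalSpin N σ)^2)

/-- The `p`-th term of the series bounding `1 - f_N` from above. -/
def seriesTerm (α β fh c : ℝ) (p : ℕ) : ℝ :=
  (1/(β * bcoef α p)) * (β/c + Real.log (2 * Real.sqrt (c * bcoef α p))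
    + β * fh * (2:ℝ)^((p:ℝ)/2) *
      Real.log (2 * Real.sqrt (c * bcoef α p) * (1 + Real.sqrt (2*Real.pi*Real.exp 1))))

theorem aux_lip_cont (n : ℕ) (K : ℝ) (f : (Fin n → ℝ) → ℝ)
    (hf : ∀ x y, |f x - f y| ≤ K * ∑ i, |x i - y i|) : Continuous f := by
  rw [continuous_iff_continuousAt]
  intro a
  rw [ContinuousAt, tendsto_iff_dist_tendsto_zero]
  have h0 : Tendsto (fun x : Fin n → ℝ => K * ∑ i, |x i - a i|) (nhds a) (nhds 0) := by
    have : Continuous (fun x : Fin n → ℝ => K * ∑ i, |x i - a i|) := by fun_prop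
    have h := this.tendsto a
    simpa using h
  exact squeeze_zero (fun _ => dist_nonneg) (fun x => by rw [Real.dist_eq]; exact hf x a) h0

theorem aux_int_exp_abs (K : ℝ) : Integrable (fun x : ℝ => Real.exp (K * |x|)) (gaussianReal 0 1) := by
  have h1 := integrable_exp_mul_gaussianReal (μ := 0) (v := 1) K
  have h2 := integrable_exp_mul_gaussianReal (μ := 0) (v := 1) (-K)
  refine (h1.add h2).mono' (by fun_prop) (ae_of_all _ fun x => ?_)
  rw [Real.norm_eq_abs, abs_of_pos (Real.exp_pos _)]
  simp only [Pi.add_apply]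
  rcases abs_cases x with ⟨h, _⟩ | ⟨h, _⟩ <;> rw [h]
  · linarith [Real.exp_pos (-K * x)]
  · have : K * -x = -K * x := by ring
    rw [this]
    linarith [Real.exp_pos (K * x)]

theorem aux_int_exp (n : ℕ) (K : ℝ) (f : (Fin n → ℝ) → ℝ)
    (hf : ∀ x y, |f x - f y| ≤ K * ∑ i, |x i - y i|) :
    Integrable (fun x => Real.exp (f x)) (Measure.pi fun _ : Fin n => gaussianReal 0 1) := by
  have h := Integrable.fintype_prod (μ := fun _ : Fin n => gaussianReal 0 1)
    (f := fun _ x => Real.exp (K * |x|)) (fun _ => aux_int_exp_abs K)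
  refine (h.const_mul (Real.exp (f 0))).mono' ?_ (ae_of_all _ fun x => ?_)
  · exact (Real.continuous_exp.comp (aux_lip_cont n K f hf)).aestronglyMeasurable
  · rw [Real.norm_eq_abs, abs_of_pos (Real.exp_pos _), ← Real.exp_sum, ← Real.exp_add, Real.exp_le_exp,
      ← Finset.mul_sum]
    have := (abs_le.1 (hf x 0)).2
    simp at this
    linarith

theorem aux_int_lip (n : ℕ) (K : ℝ) (f : (Fin n → ℝ) → ℝ)
    (hf : ∀ x y, |f x - f y| ≤ K * ∑ i, |x i - y i|) :
    Integrable f (Measure.pi fun _ : Fin n => gaussianReal 0 1) := by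
  have h1 := aux_int_exp n K f hf
  have h2 := aux_int_exp n K (fun x => - f x) (fun x y => by
    have := hf x y
    rwa [show -f x - -f y = -(f x - f y) by ring, abs_neg])
  refine (h1.add h2).mono' (aux_lip_cont n K f hf).aestronglyMeasurable (ae_of_all _ fun x => ?_)
  rw [Real.norm_eq_abs]
  simp only [Pi.add_apply]
  have e1 := Real.add_one_le_exp (f x)
  have e2 := Real.add_one_le_exp (-f x)
  have e3 := Real.exp_pos (f x)
  have e4 := Real.exp_pos (-f x)
  rcases abs_cases (f x) with ⟨h, _⟩ | ⟨h, _⟩ <;> rw [h] <;> linarith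

theorem aux_jensen {Ω : Type*} [MeasurableSpace Ω] (μ : Measure Ω) [IsProbabilityMeasure μ]
    (f : Ω → ℝ) (h1 : Integrable f μ) (h2 : Integrable (fun x => Real.exp (f x)) μ) :
    Real.exp (∫ x, f x ∂μ) ≤ ∫ x, Real.exp (f x) ∂μ := by
  set m := ∫ x, f x ∂μ with hm
  have : ∫ x, (Real.exp m * (1 - m) + Real.exp m * f x) ∂μ ≤ ∫ x, Real.exp (f x) ∂μ := by
    refine integral_mono ((integrable_const _).add (h1.const_mul _)) h2 fun x => ?_
    have e := Real.add_one_le_exp (f x - m)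
    have : Real.exp (f x) = Real.exp m * Real.exp (f x - m) := by rw [← Real.exp_add]; ring_nf
    simp only
    rw [this]
    nlinarith [Real.exp_pos m]
  rw [integral_add (integrable_const _) (h1.const_mul _), integral_const, integral_const_mul, ← hm] at this
  simp at this
  linarith

theorem aux_gauss1 (K : ℝ) (φ : ℝ → ℝ) (hφ : ∀ x y, |φ x - φ y| ≤ K * |x - y|)
    (i0 : Integrable φ (gaussianReal 0 1))
    (i1 : Integrable (fun x => Real.exp (φ x)) (gaussianReal 0 1))
    (i2 : Integrable (fun x => Real.exp (-φ x)) (gaussianReal 0 1)) :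
    ∫ x, Real.exp (φ x) ∂(gaussianReal 0 1) ≤ Real.exp (K^2 + ∫ x, φ x ∂(gaussianReal 0 1)) := by
  set γ := gaussianReal 0 1 with hγ
  set A := ∫ x, Real.exp (φ x) ∂γ
  set B := ∫ x, Real.exp (-φ x) ∂γ
  have hA : 0 ≤ A := integral_nonneg fun x => (Real.exp_pos _).le
  have hB : Real.exp (-∫ x, φ x ∂γ) ≤ B := by
    have := aux_jensen γ (fun x => - φ x) i0.neg i2
    rwa [integral_neg] at this
  have j1 : Integrable (fun x => Real.exp (K * x)) γ := integrable_exp_mul_gaussianReal K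
  have j2 : Integrable (fun x => Real.exp (-K * x)) γ := integrable_exp_mul_gaussianReal (-K)
  have hm : ∀ t : ℝ, ∫ x, Real.exp (t * x) ∂γ = Real.exp (t^2/2) := by
    intro t
    have := congrFun (mgf_id_gaussianReal (μ := 0) (v := 1)) t
    simp [mgf] at this
    simpa [hγ] using this
  have key : ∀ x y, Real.exp (φ x) * Real.exp (-φ y) + Real.exp (-φ x) * Real.exp (φ y)
      ≤ Real.exp (K * x) * Real.exp (-K * y) + Real.exp (-K * x) * Real.exp (K * y) := by
    intro x y
    have h : Real.cosh (φ x - φ y) ≤ Real.cosh (K * (x - y)) := by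
      rw [Real.cosh_le_cosh, abs_mul]
      exact (hφ x y).trans (mul_le_mul_of_nonneg_right (le_abs_self K) (abs_nonneg _))
    rw [Real.cosh_eq, Real.cosh_eq] at h
    simp only [← Real.exp_add]
    have e1 : φ x + -φ y = φ x - φ y := by ring
    have e2 : -φ x + φ y = -(φ x - φ y) := by ring
    have e3 : K * x + -K * y = K * (x - y) := by ring
    have e4 : -K * x + K * y = -(K * (x - y)) := by ring
    rw [e1, e2, e3, e4]
    linarith
  have key2 : ∀ x, Real.exp (φ x) * B + Real.exp (-φ x) * A
      ≤ Real.exp (K * x) * Real.exp (K^2/2) + Real.exp (-K * x) * Real.exp (K^2/2) := by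
    intro x
    have := integral_mono ((i2.const_mul (Real.exp (φ x))).add (i1.const_mul (Real.exp (-φ x))))
      ((j2.const_mul (Real.exp (K*x))).add (j1.const_mul (Real.exp (-K * x)))) (key x)
    simp only [Pi.add_apply] at this
    rw [integral_add (i2.const_mul _) (i1.const_mul _), integral_add (j2.const_mul _) (j1.const_mul _)] at this
    simp only [integral_const_mul, hm] at this
    simpa using this
  have key3 : A * B + B * A ≤ Real.exp (K^2/2) * Real.exp (K^2/2) + Real.exp (K^2/2) * Real.exp (K^2/2) := by
    have := integral_mono ((i1.mul_const B).add (i2.mul_const A))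
      ((j1.mul_const (Real.exp (K^2/2))).add (j2.mul_const (Real.exp (K^2/2)))) key2
    simp only [Pi.add_apply] at this
    rw [integral_add (i1.mul_const _) (i2.mul_const _), integral_add (j1.mul_const _) (j2.mul_const _)] at this
    simp only [integral_mul_const, hm] at this
    simpa using this
  rw [← Real.exp_add] at key3
  have e : K^2/2 + K^2/2 = K^2 := by ring
  rw [e] at key3
  have h4 : A * Real.exp (-∫ x, φ x ∂γ) ≤ Real.exp (K^2) := by
    have := mul_le_mul_of_nonneg_left hB hA
    linarith
  rw [Real.exp_neg, ← div_eq_mul_inv, div_le_iff₀ (Real.exp_pos _), ← Real.exp_add] at h4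
  exact h4

theorem aux_gaussN (K : ℝ) : ∀ (n : ℕ) (f : (Fin n → ℝ) → ℝ)
    (_ : ∀ x y, |f x - f y| ≤ K * ∑ i, |x i - y i|),
    ∫ x, Real.exp (f x) ∂(Measure.pi fun _ : Fin n => gaussianReal 0 1)
      ≤ Real.exp (n * K^2 + ∫ x, f x ∂(Measure.pi fun _ : Fin n => gaussianReal 0 1)) := by
  intro n
  induction n with
  | zero =>
    intro f hf
    rw [Measure.pi_of_empty]
    simp
  | succ n ih =>
    intro f hf
    set γ := gaussianReal 0 1 with hγ
    set μ := Measure.pi fun _ : Fin n => gaussianReal 0 1 with hμ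
    have mp := (measurePreserving_piFinSuccAbove (fun _ : Fin (n+1) => gaussianReal 0 1) 0).symm
    have hcons : ∀ p : ℝ × (Fin n → ℝ), (MeasurableEquiv.piFinSuccAbove (fun _ => ℝ) (0 : Fin (n+1))).symm p
        = Fin.cons p.1 p.2 := by
      intro p
      rw [MeasurableEquiv.piFinSuccAbove_symm_apply, Fin.insertNthEquiv]
      simp
    have E : ∀ g : (Fin (n+1) → ℝ) → ℝ, ∫ x, g x ∂(Measure.pi fun _ : Fin (n+1) => gaussianReal 0 1)
        = ∫ p, g (Fin.cons p.1 p.2) ∂(γ.prod μ) := by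
      intro g
      rw [← mp.integral_comp (MeasurableEquiv.measurableEmbedding _)]
      simp only [hcons]; rfl
    have I : ∀ g : (Fin (n+1) → ℝ) → ℝ, Integrable g (Measure.pi fun _ : Fin (n+1) => gaussianReal 0 1) →
        Integrable (fun p : ℝ × (Fin n → ℝ) => g (Fin.cons p.1 p.2)) (γ.prod μ) := by
      intro g hg
      have := (mp.integrable_comp_emb (MeasurableEquiv.measurableEmbedding _)).2 hg
      simpa only [Function.comp_def, hcons] using this
    have If := I _ (aux_int_lip _ K f hf)
    have Ie := I _ (aux_int_exp _ K f hf)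
    have hx : ∀ x0, ∀ x y : Fin n → ℝ, |f (Fin.cons x0 x) - f (Fin.cons x0 y)| ≤ K * ∑ i, |x i - y i| := by
      intro x0 x y
      have := hf (Fin.cons x0 x) (Fin.cons x0 y)
      rw [Fin.sum_univ_succ] at this
      simpa using this
    have h0 : ∀ x y (z : Fin n → ℝ), |f (Fin.cons x z) - f (Fin.cons y z)| ≤ K * |x - y| := by
      intro x y z
      have := hf (Fin.cons x z) (Fin.cons y z)
      rw [Fin.sum_univ_succ] at this
      simpa using this
    set φ : ℝ → ℝ := fun x => ∫ z, f (Fin.cons x z) ∂μ with hφ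
    have ifx : ∀ x, Integrable (fun z => f (Fin.cons x z)) μ := fun x => aux_int_lip n K _ (hx x)
    have hφL : ∀ x y, |φ x - φ y| ≤ K * |x - y| := by
      intro x y
      rw [hφ]
      simp only
      rw [← integral_sub (ifx x) (ifx y)]
      have := norm_integral_le_of_norm_le_const (μ := μ) (f := fun z => f (Fin.cons x z) - f (Fin.cons y z))
        (C := K * |x - y|) (ae_of_all _ fun z => (h0 x y z))
      simpa using this
    have hφ1 : ∀ x y : Fin 1 → ℝ, |φ (x 0) - φ (y 0)| ≤ K * ∑ i, |x i - y i| := by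
      intro x y; simpa using hφL (x 0) (y 0)
    have mp1 : MeasurePreserving (fun x : Fin 1 → ℝ => x 0) (Measure.pi fun _ : Fin 1 => gaussianReal 0 1) γ :=
      measurePreserving_eval (fun _ : Fin 1 => gaussianReal 0 1) 0
    have cφ : Continuous φ := by
      rw [show φ = (fun x : Fin 1 → ℝ => φ (x 0)) ∘ (fun t => fun _ => t) from rfl]
      exact (aux_lip_cont 1 K _ hφ1).comp (by fun_prop)
    have i0 : Integrable φ γ := (mp1.integrable_comp cφ.aestronglyMeasurable).1 (aux_int_lip 1 K _ hφ1)
    have i1 : Integrable (fun x => Real.exp (φ x)) γ :=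
      (mp1.integrable_comp (by fun_prop)).1 (aux_int_exp 1 K _ hφ1)
    have i2 : Integrable (fun x => Real.exp (-φ x)) γ :=
      (mp1.integrable_comp (g := fun x => Real.exp (-φ x)) (by fun_prop)).1
        (aux_int_exp 1 K (fun x => - φ (x 0)) (fun x y => by
          have := hφ1 x y
          rwa [show -φ (x 0) - -φ (y 0) = -(φ (x 0) - φ (y 0)) by ring, abs_neg]))
    have g1 := aux_gauss1 K φ hφL i0 i1 i2
    rw [E, E, integral_prod _ If, integral_prod _ Ie]
    calc ∫ x, ∫ z, Real.exp (f (Fin.cons x z)) ∂μ ∂γ ≤ ∫ x, Real.exp (n * K^2) * Real.exp (φ x) ∂γ := by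
          refine integral_mono Ie.integral_prod_left (i1.const_mul _) fun x => ?_
          simp only
          rw [← Real.exp_add]
          exact ih _ (hx x)
      _ = Real.exp (n * K^2) * ∫ x, Real.exp (φ x) ∂γ := integral_const_mul _ _
      _ ≤ Real.exp (n * K^2) * Real.exp (K^2 + ∫ x, φ x ∂γ) :=
          mul_le_mul_of_nonneg_left g1 (Real.exp_pos _).le
      _ = _ := by
          rw [← Real.exp_add]; push_cast; ring_nf; rfl

/-- exponential moment of the difference of independent copies -/
theorem aux_gauss_diff (K : ℝ) (n : ℕ) (f : (Fin n → ℝ) → ℝ)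
    (hf : ∀ x y, |f x - f y| ≤ K * ∑ i, |x i - y i|) :
    Integrable (fun p : (Fin n → ℝ) × (Fin n → ℝ) => Real.exp (f p.1 - f p.2))
      ((Measure.pi fun _ : Fin n => gaussianReal 0 1).prod (Measure.pi fun _ : Fin n => gaussianReal 0 1)) ∧
    ∫ p, Real.exp (f p.1 - f p.2) ∂((Measure.pi fun _ : Fin n => gaussianReal 0 1).prod
      (Measure.pi fun _ : Fin n => gaussianReal 0 1)) ≤ Real.exp (2 * n * K^2) := by
  have hf' : ∀ x y, |(fun x => -f x) x - (fun x => -f x) y| ≤ K * ∑ i, |x i - y i| := fun x y => by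
    have := hf x y
    rwa [show (fun x => -f x) x - (fun x => -f x) y = -(f x - f y) by ring, abs_neg]
  have e : (fun p : (Fin n → ℝ) × (Fin n → ℝ) => Real.exp (f p.1 - f p.2))
      = fun p => Real.exp (f p.1) * Real.exp (- f p.2) := by
    ext p; rw [← Real.exp_add, sub_eq_add_neg]
  rw [e]
  refine ⟨(aux_int_exp n K f hf).mul_prod (aux_int_exp n K _ hf'), ?_⟩
  rw [integral_prod_mul (fun x => Real.exp (f x)) (fun x => Real.exp (-f x))]
  have h1 := aux_gaussN K n f hf
  have h2 := aux_gaussN K n _ hf'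
  refine (mul_le_mul h1 h2 (integral_nonneg fun x => (Real.exp_pos _).le) (Real.exp_pos _).le).trans ?_
  rw [← Real.exp_add, integral_neg, Real.exp_le_exp]
  apply le_of_eq; ring

def auxW (n : ℕ) (U : (Fin n → Bool) → ℝ) (κ : ℝ) (η : Fin n → ℝ) (σ : Fin n → Bool) : ℝ :=
  U σ + κ * ∑ i, η i * spin (σ i)

def auxLZ (n : ℕ) (s : Finset (Fin n → Bool)) (U : (Fin n → Bool) → ℝ) (κ : ℝ) (η : Fin n → ℝ) : ℝ :=
  Real.log (∑ σ ∈ s, Real.exp (auxW n U κ η σ))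

def auxS (n : ℕ) (σ : Fin n → Bool) : ℝ := ∑ i, spin (σ i)

theorem aux_abs_spin (b : Bool) : |spin b| = 1 := by
  cases b <;> simp [spin]

theorem aux_abs_S (n : ℕ) (σ : Fin n → Bool) : |auxS n σ| ≤ n := by
  unfold auxS
  refine (Finset.abs_sum_le_sum_abs _ _).trans ?_
  simp [aux_abs_spin]

theorem aux_LZ_lip (n : ℕ) (s : Finset (Fin n → Bool)) (U : (Fin n → Bool) → ℝ) (κ : ℝ) (hκ : 0 ≤ κ)
    (x y : Fin n → ℝ) : |auxLZ n s U κ x - auxLZ n s U κ y| ≤ κ * ∑ i, |x i - y i| := by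
  rcases s.eq_empty_or_nonempty with rfl | hs
  · simp only [auxLZ, Finset.sum_empty, sub_self, abs_zero]
    positivity
  have main : ∀ x y : Fin n → ℝ, auxLZ n s U κ x ≤ auxLZ n s U κ y + κ * ∑ i, |x i - y i| := by
    intro x y
    have hp : 0 < ∑ σ ∈ s, Real.exp (auxW n U κ y σ) := Finset.sum_pos (fun _ _ => Real.exp_pos _) hs
    have hp' : 0 < ∑ σ ∈ s, Real.exp (auxW n U κ x σ) := Finset.sum_pos (fun _ _ => Real.exp_pos _) hs
    unfold auxLZ
    rw [← Real.log_exp (κ * ∑ i, |x i - y i|), ← Real.log_mul hp.ne' (Real.exp_pos _).ne']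
    apply Real.log_le_log hp'
    rw [Finset.sum_mul]
    refine Finset.sum_le_sum fun σ _ => ?_
    rw [← Real.exp_add, Real.exp_le_exp]
    unfold auxW
    have : ∑ i, x i * spin (σ i) ≤ ∑ i, y i * spin (σ i) + ∑ i, |x i - y i| := by
      rw [← Finset.sum_add_distrib]
      refine Finset.sum_le_sum fun i _ => ?_
      have : (x i - y i) * spin (σ i) ≤ |x i - y i| := by
        refine (le_abs_self _).trans ?_
        rw [abs_mul, aux_abs_spin, mul_one]
      linarith
    nlinarith
  rw [abs_le]
  have h1 := main x y
  have h2 := main y x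
  simp only [abs_sub_comm (y _)] at h2
  constructor <;> linarith

theorem aux_fin_jensen {X : Type*} [Fintype X] [Nonempty X] (a b : X → ℝ) :
    Real.log (∑ x, Real.exp (a x)) + (∑ x, b x * Real.exp (a x)) / (∑ x, Real.exp (a x))
      ≤ Real.log (∑ x, Real.exp (a x + b x)) := by
  have hp : 0 < ∑ x, Real.exp (a x) := Finset.sum_pos (fun _ _ => Real.exp_pos _) Finset.univ_nonempty
  set Z := ∑ x, Real.exp (a x) with hZ
  set m := (∑ x, b x * Real.exp (a x)) / Z with hm
  rw [← Real.log_exp m, ← Real.log_mul hp.ne' (Real.exp_pos _).ne']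
  apply Real.log_le_log (by positivity)
  have : ∑ x, Real.exp m * (Real.exp (a x) * (1 - m) + b x * Real.exp (a x)) ≤ ∑ x, Real.exp (a x + b x) := by
    refine Finset.sum_le_sum fun x _ => ?_
    have e := Real.add_one_le_exp (b x - m)
    have e2 : Real.exp (a x + b x) = Real.exp m * (Real.exp (a x) * Real.exp (b x - m)) := by
      rw [← Real.exp_add, ← Real.exp_add]; ring_nf
    rw [e2]
    apply mul_le_mul_of_nonneg_left _ (Real.exp_pos _).le
    nlinarith [Real.exp_pos (a x)]
  rw [← Finset.mul_sum, Finset.sum_add_distrib, ← Finset.sum_mul, ← hZ] at this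
  have e3 : ∑ x, b x * Real.exp (a x) = m * Z := by rw [hm]; field_simp
  rw [e3] at this
  linarith

theorem aux_block (n r : ℕ) (hn : 0 < n) (hr : 0 < r) :
    ∃ q : (Fin n → Bool) → Fin r, ∀ σ τ, q σ = q τ → |auxS n σ - auxS n τ| ≤ 2 * n / r := by
  have hn' : (0:ℝ) < n := by exact_mod_cast hn
  have hr' : (0:ℝ) < r := by exact_mod_cast hr
  let u : (Fin n → Bool) → ℝ := fun σ => (auxS n σ + n) * r / (2 * n)
  have hu0 : ∀ σ, 0 ≤ u σ := by
    intro σ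
    have := (abs_le.1 (aux_abs_S n σ)).1
    have h : 0 ≤ auxS n σ + n := by linarith
    positivity
  have hu1 : ∀ σ, u σ ≤ r := by
    intro σ
    have := (abs_le.1 (aux_abs_S n σ)).2
    simp only [u]
    rw [div_le_iff₀ (by positivity)]
    nlinarith
  have hb : ∀ σ, ((min ⌊u σ⌋₊ (r-1) : ℕ) : ℝ) ≤ u σ ∧ u σ ≤ ((min ⌊u σ⌋₊ (r-1) : ℕ) : ℝ) + 1 := by
    intro σ
    have h1 := Nat.floor_le (hu0 σ)
    have h2 := (Nat.lt_floor_add_one (u σ)).le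
    rcases le_total ⌊u σ⌋₊ (r-1) with h | h
    · rw [min_eq_left h]; exact ⟨h1, h2⟩
    · rw [min_eq_right h]
      constructor
      · have : ((r-1 : ℕ):ℝ) ≤ (⌊u σ⌋₊ : ℝ) := by exact_mod_cast h
        linarith
      · have : ((r-1 : ℕ):ℝ) + 1 = r := by
          have : r - 1 + 1 = r := by omega
          exact_mod_cast this
        rw [this]; exact hu1 σ
  refine ⟨fun σ => ⟨min ⌊u σ⌋₊ (r-1), by have := min_le_right ⌊u σ⌋₊ (r-1); omega⟩, fun σ τ h => ?_⟩
  have h' : min ⌊u σ⌋₊ (r-1) = min ⌊u τ⌋₊ (r-1) := by simpa using congrArg Fin.val h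
  have a1 := hb σ
  have a2 := hb τ
  rw [← h'] at a2
  have h3 : |u σ - u τ| ≤ 1 := by rw [abs_le]; constructor <;> linarith [a1.1, a1.2, a2.1, a2.2]
  have h4 : auxS n σ - auxS n τ = (2 * n / r) * (u σ - u τ) := by
    simp only [u]; field_simp; ring
  have h5 : (0:ℝ) ≤ 2 * n / r := by positivity
  rw [h4, abs_mul, abs_of_nonneg h5]
  nlinarith

theorem aux_log_fin (P r M d Z : ℝ) (hP : 0 < P) (hr : 0 < r)
    (h : Real.exp (-d) * (P^2 / r * Real.exp (-M)) ≤ Z) :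
    2 * Real.log P - d - Real.log r - M ≤ Real.log Z := by
  refine le_trans (le_of_eq ?_) (Real.log_le_log (by positivity) h)
  rw [Real.log_mul (by positivity) (by positivity), Real.log_mul (by positivity) (by positivity),
    Real.log_div (by positivity) (by positivity), Real.log_pow, Real.log_exp, Real.log_exp]
  push_cast
  ring

set_option maxHeartbeats 1000000 in
theorem aux_step_pt (n r : ℕ) (hr : 0 < r) (U : (Fin n → Bool) → ℝ) (w κ L D : ℝ) (hw : 0 ≤ w) (hL : 0 < L)
    (q : (Fin n → Bool) → Fin r) (hq : ∀ σ τ, q σ = q τ → |auxS n σ - auxS n τ| ≤ D)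
    (x y : Fin n → ℝ) :
    2 * auxLZ n Finset.univ (fun σ => U σ + 2 * w * (auxS n σ)^2) κ x - w * D^2 - Real.log r
      - L * ((∑ k : Fin r, Real.exp (
          auxLZ n (Finset.univ.filter fun σ => q σ = k) (fun σ => U σ + 2 * w * (auxS n σ)^2) κ x / L
          - auxLZ n (Finset.univ.filter fun σ => q σ = k) (fun σ => U σ + 2 * w * (auxS n σ)^2) κ y / L))
          / (r * Real.exp 1) + Real.log r)
    ≤ Real.log (∑ σ : (Fin n → Bool) × (Fin n → Bool),
        Real.exp (auxW n U κ x σ.1 + auxW n U κ y σ.2 + w * (auxS n σ.1 + auxS n σ.2)^2)) := by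
  have hr' : (0:ℝ) < r := by exact_mod_cast hr
  set V : (Fin n → Bool) → ℝ := fun σ => U σ + 2 * w * (auxS n σ)^2 with hV
  set s : Fin r → Finset (Fin n → Bool) := fun k => Finset.univ.filter fun σ => q σ = k with hs
  set A : Fin r → ℝ := fun k => ∑ σ ∈ s k, Real.exp (auxW n V κ x σ) with hA
  set B : Fin r → ℝ := fun k => ∑ σ ∈ s k, Real.exp (auxW n V κ y σ) with hB
  set W := ∑ k : Fin r, Real.exp (auxLZ n (s k) V κ x / L - auxLZ n (s k) V κ y / L) with hW
  set M := L * (W / (r * Real.exp 1) + Real.log r) with hM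
  have hA0 : ∀ k, 0 ≤ A k := fun k => Finset.sum_nonneg fun _ _ => (Real.exp_pos _).le
  have hsum : ∑ k, A k = ∑ σ, Real.exp (auxW n V κ x σ) := by
    simp only [hA, hs]
    exact Finset.sum_fiberwise _ _ _
  have hAB : ∀ k, A k ^ 2 * Real.exp (-M) ≤ A k * B k := by
    intro k
    rcases (s k).eq_empty_or_nonempty with h | h
    · simp [hA, hB, h]
    have pA : 0 < A k := Finset.sum_pos (fun _ _ => Real.exp_pos _) h
    have pB : 0 < B k := Finset.sum_pos (fun _ _ => Real.exp_pos _) h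
    have g1 : Real.exp (auxLZ n (s k) V κ x / L - auxLZ n (s k) V κ y / L) ≤ W :=
      Finset.single_le_sum (f := fun k => Real.exp (auxLZ n (s k) V κ x / L - auxLZ n (s k) V κ y / L))
        (fun _ _ => (Real.exp_pos _).le) (Finset.mem_univ k)
    have pW : 0 < W := lt_of_lt_of_le (Real.exp_pos _) g1
    have g2 := (Real.le_log_iff_exp_le pW).2 g1
    have g3 := Real.log_le_sub_one_of_pos (x := W / (r * Real.exp 1)) (by positivity)
    rw [Real.log_div pW.ne' (by positivity), Real.log_mul hr'.ne' (Real.exp_pos _).ne', Real.log_exp] at g3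
    have g4 : (Real.log (A k) - Real.log (B k)) / L ≤ W / (r * Real.exp 1) + Real.log r := by
      have : (Real.log (A k) - Real.log (B k)) / L
        = auxLZ n (s k) V κ x / L - auxLZ n (s k) V κ y / L := by simp only [auxLZ, hA, hB]; ring
      rw [this]; linarith
    rw [div_le_iff₀ hL, mul_comm _ L, ← hM] at g4
    have g5 : A k * Real.exp (-M) ≤ B k := by
      rw [← Real.log_le_log_iff (by positivity) pB, Real.log_mul pA.ne' (Real.exp_pos _).ne', Real.log_exp]
      linarith
    nlinarith
  have hcs : (∑ k, A k)^2 ≤ r * ∑ k, A k ^ 2 := by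
    have := sq_sum_le_card_mul_sum_sq (s := (Finset.univ : Finset (Fin r))) (f := A)
    simpa using this
  have hZ : Real.exp (- (w * D^2)) * ∑ k, A k * B k ≤ ∑ σ : (Fin n → Bool) × (Fin n → Bool),
        Real.exp (auxW n U κ x σ.1 + auxW n U κ y σ.2 + w * (auxS n σ.1 + auxS n σ.2)^2) := by
    rw [Fintype.sum_prod_type, ← Finset.sum_fiberwise Finset.univ q, Finset.mul_sum]
    refine Finset.sum_le_sum fun k _ => ?_
    simp only [hA, hB]
    rw [Finset.sum_mul_sum, Finset.mul_sum]
    refine Finset.sum_le_sum fun σ hσ => ?_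
    rw [Finset.mul_sum]
    refine le_trans ?_ (Finset.sum_le_sum_of_subset_of_nonneg (Finset.subset_univ (s k))
      (fun _ _ _ => (Real.exp_pos _).le))
    refine Finset.sum_le_sum fun τ hτ => ?_
    rw [← Real.exp_add, ← Real.exp_add, Real.exp_le_exp]
    have e1 : q σ = k := (Finset.mem_filter.1 hσ).2
    have e2 : q τ = k := (Finset.mem_filter.1 hτ).2
    have e3 := hq σ τ (e1.trans e2.symm)
    have e4 : (auxS n σ - auxS n τ)^2 ≤ D^2 := by
      rw [← sq_abs]; exact pow_le_pow_left₀ (abs_nonneg _) e3 2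
    simp only [auxW, hV]
    nlinarith [mul_le_mul_of_nonneg_left e4 hw]
  have hAp : 0 < ∑ k, A k := by
    rw [hsum]; exact Finset.sum_pos (fun _ _ => Real.exp_pos _) Finset.univ_nonempty
  have hfin : Real.exp (-(w * D^2)) * ((∑ k, A k)^2 / r * Real.exp (-M)) ≤
      ∑ σ : (Fin n → Bool) × (Fin n → Bool),
        Real.exp (auxW n U κ x σ.1 + auxW n U κ y σ.2 + w * (auxS n σ.1 + auxS n σ.2)^2) := by
    refine le_trans (mul_le_mul_of_nonneg_left ?_ (Real.exp_pos _).le) hZ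
    refine le_trans ?_ (Finset.sum_le_sum fun k _ => hAB k)
    rw [← Finset.sum_mul]
    apply mul_le_mul_of_nonneg_right _ (Real.exp_pos _).le
    rw [div_le_iff₀ hr', mul_comm]; exact hcs
  have := aux_log_fin _ _ _ _ _ hAp hr' hfin
  rw [hsum] at this
  exact this

theorem aux_gibbs_int (n : ℕ) (U : (Fin n → Bool) → ℝ) (κ : ℝ) (F : (Fin n → Bool) → ℝ) :
    Integrable (fun η => (∑ σ, F σ * Real.exp (auxW n U κ η σ)) / ∑ σ, Real.exp (auxW n U κ η σ))
      (Measure.pi fun _ : Fin n => gaussianReal 0 1) := by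
  have hp : ∀ η, 0 < ∑ σ, Real.exp (auxW n U κ η σ) :=
    fun η => Finset.sum_pos (fun _ _ => Real.exp_pos _) Finset.univ_nonempty
  have hc : Continuous (fun η => (∑ σ, F σ * Real.exp (auxW n U κ η σ)) / ∑ σ, Real.exp (auxW n U κ η σ)) := by
    refine Continuous.div ?_ ?_ (fun η => (hp η).ne') <;> unfold auxW <;> fun_prop
  refine (integrable_const (∑ σ, |F σ|)).mono' hc.aestronglyMeasurable (ae_of_all _ fun η => ?_)
  rw [Real.norm_eq_abs, abs_div, abs_of_pos (hp η), div_le_iff₀ (hp η)]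
  refine (Finset.abs_sum_le_sum_abs _ _).trans ?_
  rw [Finset.mul_sum]
  refine Finset.sum_le_sum fun σ _ => ?_
  rw [abs_mul, abs_of_pos (Real.exp_pos _)]
  exact mul_le_mul_of_nonneg_right (Finset.single_le_sum (f := fun σ => |F σ|) (fun _ _ => abs_nonneg _)
    (Finset.mem_univ σ)) (Real.exp_pos _).le

def auxG (n : ℕ) (U : (Fin n → Bool) → ℝ) (κ : ℝ) (η : Fin n → ℝ) : ℝ :=
  (∑ σ, (auxS n σ)^2 * Real.exp (auxW n U κ η σ)) / ∑ σ, Real.exp (auxW n U κ η σ)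

def auxG2 (n : ℕ) (U : (Fin n → Bool) → ℝ) (w κ : ℝ) (p : (Fin n → ℝ) × (Fin n → ℝ)) : ℝ :=
  (∑ σ : (Fin n → Bool) × (Fin n → Bool), (auxS n σ.1 + auxS n σ.2)^2 *
      Real.exp (auxW n U κ p.1 σ.1 + auxW n U κ p.2 σ.2 + w * (auxS n σ.1 + auxS n σ.2)^2)) /
  ∑ σ : (Fin n → Bool) × (Fin n → Bool),
      Real.exp (auxW n U κ p.1 σ.1 + auxW n U κ p.2 σ.2 + w * (auxS n σ.1 + auxS n σ.2)^2)

theorem aux_G2_pt (n : ℕ) (U : (Fin n → Bool) → ℝ) (w κ : ℝ) (x y : Fin n → ℝ) :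
    Real.log (∑ σ : (Fin n → Bool) × (Fin n → Bool),
        Real.exp (auxW n U κ x σ.1 + auxW n U κ y σ.2 + w * (auxS n σ.1 + auxS n σ.2)^2))
      - auxLZ n Finset.univ U κ x - auxLZ n Finset.univ U κ y ≤ w * auxG2 n U w κ (x, y) := by
  have h := aux_fin_jensen
    (fun σ : (Fin n → Bool) × (Fin n → Bool) =>
      auxW n U κ x σ.1 + auxW n U κ y σ.2 + w * (auxS n σ.1 + auxS n σ.2)^2)
    (fun σ => -(w * (auxS n σ.1 + auxS n σ.2)^2))
  have e1 : ∑ σ : (Fin n → Bool) × (Fin n → Bool),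
      Real.exp (auxW n U κ x σ.1 + auxW n U κ y σ.2 + w * (auxS n σ.1 + auxS n σ.2)^2
        + -(w * (auxS n σ.1 + auxS n σ.2)^2))
      = (∑ σ, Real.exp (auxW n U κ x σ)) * ∑ σ, Real.exp (auxW n U κ y σ) := by
    rw [Finset.sum_mul_sum, Fintype.sum_prod_type]
    refine Finset.sum_congr rfl fun σ _ => Finset.sum_congr rfl fun τ _ => ?_
    rw [← Real.exp_add]; congr 1; ring
  have hp : ∀ η, 0 < ∑ σ, Real.exp (auxW n U κ η σ) :=
    fun η => Finset.sum_pos (fun _ _ => Real.exp_pos _) Finset.univ_nonempty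
  rw [e1, Real.log_mul (hp x).ne' (hp y).ne'] at h
  have e2 : w * auxG2 n U w κ (x, y) = - ((∑ σ : (Fin n → Bool) × (Fin n → Bool),
      -(w * (auxS n σ.1 + auxS n σ.2)^2) *
        Real.exp (auxW n U κ x σ.1 + auxW n U κ y σ.2 + w * (auxS n σ.1 + auxS n σ.2)^2)) /
      ∑ σ : (Fin n → Bool) × (Fin n → Bool),
      Real.exp (auxW n U κ x σ.1 + auxW n U κ y σ.2 + w * (auxS n σ.1 + auxS n σ.2)^2)) := by
    unfold auxG2
    rw [← neg_div, ← Finset.sum_neg_distrib, ← mul_div_assoc, Finset.mul_sum]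
    congr 1
    refine Finset.sum_congr rfl fun σ _ => ?_
    ring
  rw [e2]
  unfold auxLZ
  linarith

theorem aux_G1_pt (n : ℕ) (U : (Fin n → Bool) → ℝ) (w κ : ℝ) (x : Fin n → ℝ) :
    auxLZ n Finset.univ U κ x + 2 * w * auxG n U κ x
      ≤ auxLZ n Finset.univ (fun σ => U σ + 2 * w * (auxS n σ)^2) κ x := by
  have h := aux_fin_jensen (fun σ => auxW n U κ x σ) (fun σ => 2 * w * (auxS n σ)^2)
  have e1 : ∀ σ, auxW n U κ x σ + 2 * w * (auxS n σ)^2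
      = auxW n (fun σ => U σ + 2 * w * (auxS n σ)^2) κ x σ := by
    intro σ; simp only [auxW]; ring
  simp only [e1] at h
  have e2 : 2 * w * auxG n U κ x = (∑ σ, 2 * w * (auxS n σ)^2 * Real.exp (auxW n U κ x σ))
      / ∑ σ, Real.exp (auxW n U κ x σ) := by
    unfold auxG
    rw [← mul_div_assoc, Finset.mul_sum]
    congr 1
    refine Finset.sum_congr rfl fun σ _ => ?_
    ring
  rw [e2]
  exact h

theorem aux_step_int (n r : ℕ) (hn : 0 < n) (hr : 0 < r) (U : (Fin n → Bool) → ℝ) (w κ : ℝ)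
    (hw : 0 ≤ w) (hκ : 0 < κ)
    (hI : Integrable (auxG2 n U w κ) ((Measure.pi fun _ : Fin n => gaussianReal 0 1).prod
      (Measure.pi fun _ : Fin n => gaussianReal 0 1))) :
    4 * w * ∫ x, auxG n U κ x ∂(Measure.pi fun _ : Fin n => gaussianReal 0 1)
      - (w * (2 * n / r)^2 + Real.log r + κ * Real.sqrt (2 * n) * (Real.log r + 1))
    ≤ w * ∫ p, auxG2 n U w κ p ∂((Measure.pi fun _ : Fin n => gaussianReal 0 1).prod
      (Measure.pi fun _ : Fin n => gaussianReal 0 1)) := by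
  have hr' : (0:ℝ) < r := by exact_mod_cast hr
  have hn' : (0:ℝ) < n := by exact_mod_cast hn
  obtain ⟨q, hq⟩ := aux_block n r hn hr
  set μ := Measure.pi fun _ : Fin n => gaussianReal 0 1 with hμ
  set L := κ * Real.sqrt (2 * n) with hL
  have hL0 : 0 < L := by positivity
  set V : (Fin n → Bool) → ℝ := fun σ => U σ + 2 * w * (auxS n σ)^2 with hV
  set s : Fin r → Finset (Fin n → Bool) := fun k => Finset.univ.filter fun σ => q σ = k with hs
  let φ : Fin r → (Fin n → ℝ) → ℝ := fun k x => auxLZ n (s k) V κ x / L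
  have hφ : ∀ k x y, |φ k x - φ k y| ≤ (κ / L) * ∑ i, |x i - y i| := by
    intro k x y
    have := aux_LZ_lip n (s k) V κ hκ.le x y
    simp only [φ]
    rw [← sub_div, abs_div, abs_of_pos hL0, div_mul_eq_mul_div]
    gcongr
  have hD := fun k => aux_gauss_diff (κ / L) n (φ k) (hφ k)
  have hone : 2 * n * (κ / L)^2 = 1 := by
    rw [hL, div_pow, mul_pow, Real.sq_sqrt (by positivity)]
    field_simp
  rw [hone] at hD
  have iV : Integrable (fun x => auxLZ n Finset.univ V κ x) μ := aux_int_lip n κ _ (aux_LZ_lip n _ V κ hκ.le)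
  have iU : Integrable (fun x => auxLZ n Finset.univ U κ x) μ := aux_int_lip n κ _ (aux_LZ_lip n _ U κ hκ.le)
  have iG : Integrable (fun x => auxG n U κ x) μ := aux_gibbs_int n U κ _
  have iW : Integrable (fun p : (Fin n → ℝ) × (Fin n → ℝ) => ∑ k, Real.exp (φ k p.1 - φ k p.2)) (μ.prod μ) :=
    integrable_finsetSum _ fun k _ => (hD k).1
  have bW : ∫ p, ∑ k, Real.exp (φ k p.1 - φ k p.2) ∂(μ.prod μ) ≤ r * Real.exp 1 := by
    rw [integral_finsetSum _ fun k _ => (hD k).1]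
    refine (Finset.sum_le_sum fun k _ => (hD k).2).trans ?_
    simp
  have fsti : ∀ f : (Fin n → ℝ) → ℝ, ∫ p, f p.1 ∂(μ.prod μ) = ∫ x, f x ∂μ := by
    intro f; rw [integral_fun_fst]; simp
  have sndi : ∀ f : (Fin n → ℝ) → ℝ, ∫ p, f p.2 ∂(μ.prod μ) = ∫ x, f x ∂μ := by
    intro f; rw [integral_fun_snd]; simp
  set C := w * (2 * n / r)^2 + Real.log r + L * Real.log r with hC
  have jV := (iV.comp_fst μ).const_mul 2
  have jU1 := iU.comp_fst μ
  have jU2 := iU.comp_snd μ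
  have jW := iW.const_mul (L / (r * Real.exp 1))
  have hpt : ∀ p : (Fin n → ℝ) × (Fin n → ℝ),
      2 * auxLZ n Finset.univ V κ p.1 - auxLZ n Finset.univ U κ p.1 - auxLZ n Finset.univ U κ p.2
        - (L / (r * Real.exp 1)) * (∑ k, Real.exp (φ k p.1 - φ k p.2)) - C ≤ w * auxG2 n U w κ p := by
    rintro ⟨x, y⟩
    have h1 := aux_step_pt n r hr U w κ L (2 * n / r) hw hL0 q hq x y
    have h2 := aux_G2_pt n U w κ x y
    refine le_trans ?_ h2
    refine le_trans (le_of_eq ?_) (sub_le_sub_right (sub_le_sub_right h1 _) _)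
    simp only [hC, φ, hV, hs]
    ring
  have hint := integral_mono ((((jV.sub jU1).sub jU2).sub jW).sub (integrable_const C)) (hI.const_mul w) hpt
  rw [integral_sub' (((jV.sub jU1).sub jU2).sub jW) (integrable_const C), integral_sub' ((jV.sub jU1).sub jU2) jW,
    integral_sub' (jV.sub jU1) jU2, integral_sub' jV jU1, integral_const_mul, integral_const_mul,
    integral_const_mul, fsti (fun x => auxLZ n Finset.univ V κ x), fsti (fun x => auxLZ n Finset.univ U κ x),
    sndi (fun x => auxLZ n Finset.univ U κ x)] at hint
  have hVU : ∫ x, auxLZ n Finset.univ U κ x ∂μ + 2 * w * ∫ x, auxG n U κ x ∂μ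
      ≤ ∫ x, auxLZ n Finset.univ V κ x ∂μ := by
    rw [← integral_const_mul, ← integral_add iU (iG.const_mul _)]
    exact integral_mono (iU.add (iG.const_mul _)) iV fun x => aux_G1_pt n U w κ x
  have hWL : (L / (r * Real.exp 1)) * ∫ p, ∑ k, Real.exp (φ k p.1 - φ k p.2) ∂(μ.prod μ) ≤ L := by
    have h := mul_le_mul_of_nonneg_left bW (show 0 ≤ L / (r * Real.exp 1) by positivity)
    have e : L / (r * Real.exp 1) * (r * Real.exp 1) = L := by field_simp
    rw [e] at h
    exact h
  have hc : ∫ _p : (Fin n → ℝ) × (Fin n → ℝ), C ∂(μ.prod μ) = C := by simp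
  rw [hc] at hint
  rw [hC] at hint
  linarith

def auxE (N : ℕ) : Fin (2^N) ⊕ Fin (2^N) ≃ Fin (2^(N+1)) :=
  finSumFinEquiv.trans (finCongr (by rw [pow_succ]; omega))

theorem auxE_inl (N : ℕ) (i : Fin (2^N)) (h : i.1 < 2^(N+1)) : (⟨i.1, h⟩ : Fin (2^(N+1))) = auxE N (Sum.inl i) := by
  apply Fin.ext; simp [auxE]

theorem auxE_inr (N : ℕ) (i : Fin (2^N)) (h : 2^N + i.1 < 2^(N+1)) :
    (⟨2^N + i.1, h⟩ : Fin (2^(N+1))) = auxE N (Sum.inr i) := by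
  apply Fin.ext; simp [auxE, add_comm]

/-- glue two halves -/
def auxGlue (N : ℕ) (X : Type*) : (Fin (2^N) → X) × (Fin (2^N) → X) ≃ (Fin (2^(N+1)) → X) :=
  (Equiv.sumArrowEquivProdArrow _ _ _).symm.trans ((auxE N).arrowCongr (Equiv.refl X))

theorem auxGlue_inl (N : ℕ) (X : Type*) (p : (Fin (2^N) → X) × (Fin (2^N) → X)) (i : Fin (2^N)) :
    auxGlue N X p (auxE N (Sum.inl i)) = p.1 i := by
  simp [auxGlue, Equiv.arrowCongr, Equiv.sumArrowEquivProdArrow]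

theorem auxGlue_inr (N : ℕ) (X : Type*) (p : (Fin (2^N) → X) × (Fin (2^N) → X)) (i : Fin (2^N)) :
    auxGlue N X p (auxE N (Sum.inr i)) = p.2 i := by
  simp [auxGlue, Equiv.arrowCongr, Equiv.sumArrowEquivProdArrow]

theorem aux_mp (N : ℕ) : ∃ e : ((Fin (2^N) → ℝ) × (Fin (2^N) → ℝ)) ≃ᵐ (Fin (2^(N+1)) → ℝ),
    (∀ p, e p = auxGlue N ℝ p) ∧
    MeasurePreserving e ((Measure.pi fun _ : Fin (2^N) => gaussianReal 0 1).prod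
      (Measure.pi fun _ : Fin (2^N) => gaussianReal 0 1)) (Measure.pi fun _ : Fin (2^(N+1)) => gaussianReal 0 1) := by
  have h1 := measurePreserving_sumPiEquivProdPi_symm (X := fun _ : Fin (2^N) ⊕ Fin (2^N) => ℝ)
    (fun _ => gaussianReal 0 1)
  have h2 := measurePreserving_piCongrLeft (α := fun _ : Fin (2^(N+1)) => ℝ) (fun _ => gaussianReal 0 1) (auxE N)
  refine ⟨(MeasurableEquiv.sumPiEquivProdPi (fun _ => ℝ)).symm.trans
    (MeasurableEquiv.piCongrLeft (fun _ => ℝ) (auxE N)), ?_, h1.trans h2⟩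
  intro p
  ext j
  obtain ⟨i, rfl⟩ := (auxE N).surjective j
  rw [MeasurableEquiv.trans_apply, MeasurableEquiv.coe_piCongrLeft, Equiv.piCongrLeft_apply_apply]
  rcases i with i | i
  · rw [auxGlue_inl]; rfl
  · rw [auxGlue_inr]; rfl

theorem aux_sum_glue (N : ℕ) (X : Type*) (p : (Fin (2^N) → X) × (Fin (2^N) → X)) (F : X → ℝ) :
    ∑ i, F (auxGlue N X p i) = ∑ i, F (p.1 i) + ∑ i, F (p.2 i) := by
  rw [← (auxE N).sum_comp, Fintype.sum_sum_type]
  simp only [auxGlue_inl, auxGlue_inr]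

theorem aux_S_glue (N : ℕ) (σ : (Fin (2^N) → Bool) × (Fin (2^N) → Bool)) :
    auxS (2^(N+1)) (auxGlue N Bool σ) = auxS (2^N) σ.1 + auxS (2^N) σ.2 :=
  aux_sum_glue N Bool σ spin

theorem aux_field_glue (N : ℕ) (σ : (Fin (2^N) → Bool) × (Fin (2^N) → Bool))
    (p : (Fin (2^N) → ℝ) × (Fin (2^N) → ℝ)) :
    ∑ i, auxGlue N ℝ p i * spin (auxGlue N Bool σ i)
      = ∑ i, p.1 i * spin (σ.1 i) + ∑ i, p.2 i * spin (σ.2 i) := by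
  rw [← (auxE N).sum_comp, Fintype.sum_sum_type]
  simp only [auxGlue_inl, auxGlue_inr]

theorem aux_H_glue (α : ℝ) (N : ℕ) (σ : (Fin (2^N) → Bool) × (Fin (2^N) → Bool)) :
    dysonH α (N+1) (auxGlue N Bool σ) = dysonH α N σ.1 + dysonH α N σ.2
      - (2:ℝ) ^ (-(α * ((N:ℝ)+1))) * (auxS (2^N) σ.1 + auxS (2^N) σ.2)^2 := by
  rw [dysonH, ← Finset.sum_mul_sum, ← aux_S_glue]
  simp only [auxE_inl, auxE_inr, auxGlue_inl, auxGlue_inr]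
  rw [sq]; rfl

theorem aux_W_glue (α β fh : ℝ) (N : ℕ) (σ : (Fin (2^N) → Bool) × (Fin (2^N) → Bool))
    (p : (Fin (2^N) → ℝ) × (Fin (2^N) → ℝ)) :
    auxW (2^(N+1)) (fun σ => -β * dysonH α (N+1) σ) (β * fh) (auxGlue N ℝ p) (auxGlue N Bool σ)
      = auxW (2^N) (fun σ => -β * dysonH α N σ) (β * fh) p.1 σ.1
        + auxW (2^N) (fun σ => -β * dysonH α N σ) (β * fh) p.2 σ.2
        + (β * (2:ℝ) ^ (-(α * ((N:ℝ)+1)))) * (auxS (2^N) σ.1 + auxS (2^N) σ.2)^2 := by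
  simp only [auxW]
  rw [aux_H_glue, aux_field_glue]
  ring

theorem aux_G_glue (α β fh : ℝ) (N : ℕ) (p : (Fin (2^N) → ℝ) × (Fin (2^N) → ℝ)) :
    auxG (2^(N+1)) (fun σ => -β * dysonH α (N+1) σ) (β * fh) (auxGlue N ℝ p)
      = auxG2 (2^N) (fun σ => -β * dysonH α N σ) (β * (2:ℝ) ^ (-(α * ((N:ℝ)+1)))) (β * fh) p := by
  unfold auxG auxG2
  rw [← (auxGlue N Bool).sum_comp, ← (auxGlue N Bool).sum_comp]
  simp only [aux_W_glue, aux_S_glue]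

theorem aux_gibbs_eq (α β fh : ℝ) (N : ℕ) (η : Fin (2^N) → ℝ) :
    gibbs α β fh N η (fun σ => (totalSpin N σ)^2) = auxG (2^N) (fun σ => -β * dysonH α N σ) (β * fh) η := by
  have e : ∀ σ, -β * dysonHRF α fh N η σ = auxW (2^N) (fun σ => -β * dysonH α N σ) (β * fh) η σ := by
    intro σ; simp only [dysonHRF, auxW]; ring
  simp only [gibbs, auxG, e]
  rfl

theorem aux_rec (α β fh : ℝ) (hβ : 0 < β) (hfh : 0 < fh) (N r : ℕ) (hr : 0 < r) :
    fG α β fh N - (1 / (β * bcoef α (N+1))) * (β * bcoef α (N+1) / r^2 + Real.log r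
      + β * fh * (2:ℝ)^(((N+1 : ℕ):ℝ)/2) * (Real.log r + 1)) ≤ fG α β fh (N+1) := by
  set U : (Fin (2^N) → Bool) → ℝ := fun σ => -β * dysonH α N σ with hU
  set w := β * (2:ℝ) ^ (-(α * ((N:ℝ)+1))) with hw
  have hw0 : 0 < w := by positivity
  obtain ⟨e, he, mp⟩ := aux_mp N
  have hcomp : ∀ p, auxG (2^(N+1)) (fun σ => -β * dysonH α (N+1) σ) (β * fh) (e p) = auxG2 (2^N) U w (β * fh) p := by
    intro p; rw [he]; exact aux_G_glue α β fh N p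
  have hI : Integrable (auxG2 (2^N) U w (β * fh)) ((Measure.pi fun _ : Fin (2^N) => gaussianReal 0 1).prod
      (Measure.pi fun _ : Fin (2^N) => gaussianReal 0 1)) := by
    have h := aux_gibbs_int (2^(N+1)) (fun σ => -β * dysonH α (N+1) σ) (β * fh) (fun σ => (auxS _ σ)^2)
    have h2 := (mp.integrable_comp_emb e.measurableEmbedding).2 h
    refine h2.congr (ae_of_all _ fun p => ?_)
    exact hcomp p
  have key := aux_step_int (2^N) r (by positivity) hr U w (β * fh) hw0.le (by positivity) hI
  have hint : ∫ p, auxG2 (2^N) U w (β * fh) p ∂((Measure.pi fun _ : Fin (2^N) => gaussianReal 0 1).prod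
      (Measure.pi fun _ : Fin (2^N) => gaussianReal 0 1))
      = ∫ η, gibbs α β fh (N+1) η (fun σ => (totalSpin (N+1) σ)^2) ∂ gaussianFields (2^(N+1)) := by
    simp only [aux_gibbs_eq, gaussianFields]
    rw [← mp.integral_comp e.measurableEmbedding]
    simp only [hcomp]
  have hint0 : ∫ x, auxG (2^N) U (β * fh) x ∂(Measure.pi fun _ : Fin (2^N) => gaussianReal 0 1)
      = ∫ η, gibbs α β fh N η (fun σ => (totalSpin N σ)^2) ∂ gaussianFields (2^N) := by
    simp only [aux_gibbs_eq, gaussianFields]; rfl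
  rw [hint, hint0] at key
  unfold fG
  set I0 := ∫ η, gibbs α β fh N η (fun σ => (totalSpin N σ)^2) ∂ gaussianFields (2^N)
  set I1 := ∫ η, gibbs α β fh (N+1) η (fun σ => (totalSpin (N+1) σ)^2) ∂ gaussianFields (2^(N+1))
  have hr' : (0:ℝ) < r := by exact_mod_cast hr
  have hwb : w * (2:ℝ)^(2*(N+1)) = β * bcoef α (N+1) := by
    rw [hw, bcoef, mul_assoc, ← Real.rpow_natCast, ← Real.rpow_add (by norm_num)]
    congr 2
    push_cast; ring
  have hsq : Real.sqrt (2 * ((2^N : ℕ):ℝ)) = (2:ℝ)^(((N+1 : ℕ):ℝ)/2) := by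
    rw [Real.sqrt_eq_rpow]
    have : 2 * ((2^N : ℕ):ℝ) = (2:ℝ)^((N+1 : ℕ):ℝ) := by
      rw [Real.rpow_natCast]; push_cast; ring
    rw [this, ← Real.rpow_mul (by norm_num)]
    congr 1; ring
  rw [hsq] at key
  have hD : w * (2 * ((2^N : ℕ):ℝ) / r)^2 = β * bcoef α (N+1) / r^2 := by
    rw [← hwb]; push_cast; field_simp; ring
  rw [hD] at key
  set T := β * bcoef α (N+1) / r^2 + Real.log r
      + β * fh * (2:ℝ)^(((N+1 : ℕ):ℝ)/2) * (Real.log r + 1)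
  have hb0 : 0 < β * bcoef α (N+1) := by rw [← hwb]; positivity
  have e4 : ((2:ℝ)^(2*(N+1))) = 4 * (2:ℝ)^(2*N) := by ring
  have hP : (0:ℝ) < (2:ℝ)^(2*N) := by positivity
  rw [← hwb, e4]
  have : ((4 * (2:ℝ)^(2*N)))⁻¹ * I1 - (((2:ℝ)^(2*N))⁻¹ * I0 - 1 / (w * (4 * (2:ℝ)^(2*N))) * T)
      = (w * I1 - (4 * w * I0 - T)) / (w * (4 * (2:ℝ)^(2*N))) := by
    field_simp
  have h0 : 0 ≤ (w * I1 - (4 * w * I0 - T)) / (w * (4 * (2:ℝ)^(2*N))) :=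
    div_nonneg (by linarith) (by positivity)
  linarith

theorem aux_fG_zero (α β fh : ℝ) : fG α β fh 0 = 1 := by
  have h1 : ∀ σ, (auxS (2^0) σ)^2 = 1 := by
    intro σ
    have : auxS (2^0) σ = spin (σ 0) := by simp [auxS]
    rw [this, ← sq_abs, aux_abs_spin]; norm_num
  have h2 : ∀ η, gibbs α β fh 0 η (fun σ => (totalSpin 0 σ)^2) = 1 := by
    intro η
    rw [aux_gibbs_eq, auxG]
    simp only [h1, one_mul]
    exact div_self (Finset.sum_pos (fun _ _ => Real.exp_pos _) Finset.univ_nonempty).ne'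
  unfold fG
  simp only [h2, gaussianFields]
  simp

theorem aux_fG_le (α β fh : ℝ) (N : ℕ) : fG α β fh N ≤ 1 := by
  have h : ∀ η, ‖gibbs α β fh N η (fun σ => (totalSpin N σ)^2)‖ ≤ (2:ℝ)^(2*N) := by
    intro η
    have hp : 0 < ∑ σ, Real.exp (auxW (2^N) (fun σ => -β * dysonH α N σ) (β * fh) η σ) :=
      Finset.sum_pos (fun _ _ => Real.exp_pos _) Finset.univ_nonempty
    rw [aux_gibbs_eq, auxG, Real.norm_eq_abs, abs_of_nonneg (by positivity), div_le_iff₀ hp, Finset.mul_sum]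
    refine Finset.sum_le_sum fun σ _ => ?_
    apply mul_le_mul_of_nonneg_right _ (Real.exp_pos _).le
    rw [← sq_abs]
    refine (pow_le_pow_left₀ (abs_nonneg _) (aux_abs_S _ σ) 2).trans (le_of_eq ?_)
    push_cast; ring
  unfold fG
  have h2 : ‖∫ η, gibbs α β fh N η (fun σ => (totalSpin N σ)^2) ∂ gaussianFields (2^N)‖ ≤ (2:ℝ)^(2*N) := by
    have : IsProbabilityMeasure (gaussianFields (2^N)) := by unfold gaussianFields; infer_instance
    have := norm_integral_le_of_norm_le_const (μ := gaussianFields (2^N)) (ae_of_all _ h)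
    simpa using this
  have h3 := (le_abs_self _).trans h2
  rw [inv_mul_le_iff₀ (by positivity)]
  linarith

theorem aux_b_ge (α c : ℝ) (hα2 : α < 3/2) (hc : 0 < c)
    (hc1 : 1 ≤ Real.sqrt (c * (2:ℝ)^((2:ℝ) - α))) (p : ℕ) :
    1 ≤ Real.sqrt (c * bcoef α (p+1)) := by
  refine hc1.trans (Real.sqrt_le_sqrt (mul_le_mul_of_nonneg_left ?_ hc.le))
  unfold bcoef
  apply Real.rpow_le_rpow_of_exponent_le (by norm_num)
  push_cast
  have : (0:ℝ) ≤ p := Nat.cast_nonneg p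
  nlinarith

theorem aux_e_le : Real.exp 1 ≤ 1 + Real.sqrt (2*Real.pi*Real.exp 1) := by
  have h1 := Real.exp_one_lt_d9
  have h2 := Real.exp_one_gt_d9
  have h3 := Real.pi_gt_three
  have : (2:ℝ) ≤ Real.sqrt (2*Real.pi*Real.exp 1) := by
    apply Real.le_sqrt_of_sq_le
    nlinarith
  linarith

theorem aux_term (α β c fh : ℝ) (hα2 : α < 3/2) (hc : 0 < c)
    (hc1 : 1 ≤ Real.sqrt (c * (2:ℝ)^((2:ℝ) - α))) (hβ : 0 < β) (hfh : 0 < fh) (p : ℕ) :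
    0 ≤ seriesTerm α β fh c (p+1) ∧
    fG α β fh p - seriesTerm α β fh c (p+1) ≤ fG α β fh (p+1) := by
  have hs := aux_b_ge α c hα2 hc hc1 p
  have hb : 0 < bcoef α (p+1) := by unfold bcoef; positivity
  have hes := aux_e_le
  have he1 : 1 ≤ Real.exp 1 := by have := Real.add_one_le_exp (1:ℝ); linarith
  unfold seriesTerm
  set s := Real.sqrt (c * bcoef α (p+1)) with hsdef
  set E := 1 + Real.sqrt (2*Real.pi*Real.exp 1)
  have hs2 : s^2 = c * bcoef α (p+1) := Real.sq_sqrt (by positivity)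
  have hl1 : 0 ≤ Real.log (2 * s) := Real.log_nonneg (by linarith)
  have hl2 : 0 ≤ Real.log (2 * s * E) := Real.log_nonneg (by nlinarith)
  refine ⟨by positivity, ?_⟩
  have hr1 : s ≤ (⌈s⌉₊ : ℝ) := Nat.le_ceil s
  have hr2 : (⌈s⌉₊ : ℝ) ≤ 2 * s := by
    have := (Nat.ceil_lt_add_one (show 0 ≤ s by linarith)).le
    linarith
  have hr0 : 0 < ⌈s⌉₊ := Nat.ceil_pos.2 (by linarith)
  have hr0' : (0:ℝ) < (⌈s⌉₊ : ℝ) := by exact_mod_cast hr0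
  have key := aux_rec α β fh hβ hfh p ⌈s⌉₊ hr0
  refine le_trans (sub_le_sub_left ?_ _) key
  apply mul_le_mul_of_nonneg_left _ (by positivity)
  have t1 : β * bcoef α (p+1) / (⌈s⌉₊:ℝ)^2 ≤ β / c := by
    rw [div_le_div_iff₀ (by positivity) hc]
    have : s^2 ≤ (⌈s⌉₊:ℝ)^2 := pow_le_pow_left₀ (by linarith) hr1 2
    rw [hs2] at this
    nlinarith
  have t2 : Real.log (⌈s⌉₊:ℝ) ≤ Real.log (2 * s) := Real.log_le_log hr0' hr2
  have t3 : Real.log (⌈s⌉₊:ℝ) + 1 ≤ Real.log (2 * s * E) := by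
    rw [Real.log_mul (by linarith) (by linarith)]
    have : 1 ≤ Real.log E := by
      rw [Real.le_log_iff_exp_le (by linarith)]; exact hes
    linarith
  have t4 := mul_le_mul_of_nonneg_left t3 (show 0 ≤ β * fh * (2:ℝ)^(((p+1 : ℕ):ℝ)/2) by positivity)
  linarith

theorem aux_geo (q : ℝ) (h0 : 0 < q) (h1 : q < 1) :
    HasSum (fun p : ℕ => q^(p+1)) (q / (1 - q)) ∧
    HasSum (fun p : ℕ => ((p:ℝ)+1) * q^(p+1)) (q / (1 - q)^2) := by
  constructor
  · have := (hasSum_geometric_of_lt_one h0.le h1).mul_left q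
    simpa [pow_succ', div_eq_mul_inv] using this
  · have hn : ‖q‖ < 1 := by rw [Real.norm_eq_abs, abs_of_pos h0]; exact h1
    have h := hasSum_coe_mul_geometric_of_norm_lt_one hn
    have := (hasSum_nat_add_iff' (f := fun n : ℕ => (n:ℝ) * q^n) (g := q / (1-q)^2) 1).2 h
    simpa using this

theorem aux_hasSum_eq {f g : ℕ → ℝ} {a b : ℝ} (h : HasSum f a) (e2 : ∀ p, g p = f p) (e : a = b) :
    HasSum g b := by
  rw [funext e2, ← e]; exact h

theorem aux_series (α β c fh : ℝ) (hα1 : 1 < α) (hα2 : α < 3/2) (hc : 0 < c) (hβ : 0 < β) :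
    HasSum (fun p : ℕ => seriesTerm α β fh c (p+1))
      ((1/c) * (2:ℝ)^α / ((2:ℝ)^(2:ℕ) - (2:ℝ)^α)
      + fh * (((2:ℝ) - α) * (2:ℝ)^((1:ℝ)/2 + α) / ((2:ℝ)^((3:ℝ)/2) - (2:ℝ)^α)^2 * Real.log 2
          + (2:ℝ)^α / ((2:ℝ)^((3:ℝ)/2) - (2:ℝ)^α)
            * Real.log (2 * Real.sqrt c * (1 + Real.sqrt (2 * Real.pi * Real.exp 1))))
      + (1/β) * ((2:ℝ)^α / ((2:ℝ)^(2:ℕ) - (2:ℝ)^α) * Real.log (2 * Real.sqrt c)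
          + ((2:ℝ) - α) * (2:ℝ)^(1 + α) / ((2:ℝ)^(2:ℕ) - (2:ℝ)^α)^2 * Real.log 2)) := by
  have h2 : (0:ℝ) < 2 := by norm_num
  set x := (2:ℝ)^α with hx
  set y := (2:ℝ)^((3:ℝ)/2) with hy
  have hx0 : 0 < x := by positivity
  have hy0 : 0 < y := by positivity
  have hxy : x < y := Real.rpow_lt_rpow_of_exponent_lt (by norm_num) hα2
  have hy4 : y < 4 := by
    have : y < (2:ℝ)^(2:ℝ) := Real.rpow_lt_rpow_of_exponent_lt (by norm_num) (by norm_num)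
    have e : (2:ℝ)^(2:ℝ) = 4 := by norm_num
    linarith
  have e1 : (2:ℝ)^((1:ℝ)/2 + α) = x * y / 2 := by
    rw [hx, hy, ← Real.rpow_add h2]
    have : (2:ℝ)^(α + 3/2) = 2^((1:ℝ)/2 + α) * 2 := by
      rw [show α + 3/2 = (1/2 + α) + 1 by ring, Real.rpow_add h2 _ 1, Real.rpow_one]
    rw [this]; ring
  have e2 : (2:ℝ)^(1 + α) = 2 * x := by rw [Real.rpow_add h2, Real.rpow_one]
  set E := 1 + Real.sqrt (2 * Real.pi * Real.exp 1) with hE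
  have hE0 : 0 < E := by positivity
  have g1 := aux_geo (x/4) (by positivity) (by linarith)
  have g2 := aux_geo (x/y) (by positivity) (by rw [div_lt_one hy0]; exact hxy)
  have H := (((g1.1.mul_left (1/c + Real.log (2 * Real.sqrt c) / β)).add
    (g1.2.mul_left ((2-α)/2 * Real.log 2 / β))).add
    (g2.1.mul_left (fh * Real.log (2 * Real.sqrt c * E)))).add
    (g2.2.mul_left (fh * ((2-α)/2 * Real.log 2)))
  refine aux_hasSum_eq H ?_ ?_
  · intro p
    have hb : 0 < bcoef α (p+1) := by unfold bcoef; positivity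
    have hbi : 1 / bcoef α (p+1) = (x/4)^(p+1) := by
      have : x / 4 = (2:ℝ)^(α - 2) := by
        rw [Real.rpow_sub h2]; norm_num [hx]
      rw [this, ← Real.rpow_natCast, ← Real.rpow_mul h2.le, bcoef, one_div, ← Real.rpow_neg h2.le]
      congr 1; ring
    have hbi2 : (2:ℝ)^(((p+1:ℕ):ℝ)/2) * (x/4)^(p+1) = (x/y)^(p+1) := by
      have a1 : x / 4 = (2:ℝ)^(α - 2) := by
        rw [Real.rpow_sub h2]; norm_num [hx]
      have a2 : x / y = (2:ℝ)^(α - 3/2) := by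
        rw [Real.rpow_sub h2]
      rw [a1, a2, ← Real.rpow_natCast, ← Real.rpow_natCast, ← Real.rpow_mul h2.le, ← Real.rpow_mul h2.le,
        ← Real.rpow_add h2]
      congr 1; push_cast; ring
    have hlog : Real.log (Real.sqrt (c * bcoef α (p+1)))
        = Real.log (Real.sqrt c) + (2-α)/2 * Real.log 2 * ((p:ℝ)+1) := by
      rw [Real.sqrt_mul hc.le, Real.log_mul (by positivity) (by positivity), Real.log_sqrt hb.le (x := bcoef α (p+1)), bcoef,
        Real.log_rpow h2]
      push_cast; ring
    have hl1 : Real.log (2 * Real.sqrt (c * bcoef α (p+1)))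
        = Real.log (2 * Real.sqrt c) + (2-α)/2 * Real.log 2 * ((p:ℝ)+1) := by
      rw [Real.log_mul (by positivity) (by positivity), hlog, Real.log_mul (by positivity) (by positivity)]; ring
    have hl2 : Real.log (2 * Real.sqrt (c * bcoef α (p+1)) * E)
        = Real.log (2 * Real.sqrt c * E) + (2-α)/2 * Real.log 2 * ((p:ℝ)+1) := by
      rw [Real.log_mul (by positivity) (by positivity), hl1, ← add_right_comm, ← Real.log_mul (by positivity) (by positivity)]
    unfold seriesTerm
    rw [hl1, hl2, one_div_mul_eq_div, ← hbi2, ← hbi]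
    field_simp
    ring
  · symm
    rw [e1, e2]
    have n1 : (4:ℝ) - x ≠ 0 := by linarith
    have n2 : y - x ≠ 0 := by linarith
    have n3 : (1 - x/4) = (4 - x)/4 := by ring
    have n4 : (1 - x/y) = (y - x)/y := by field_simp
    rw [n3, n4]
    norm_num only
    field_simp
    ring

/-- Theorem 1 of the paper (gaussian random fields): lower bound on the long-range
order parameter `m² = liminf_N f_N` for `1 < α < 3/2`. -/
theorem rfim_dyson_lro_bound_gaussian (α β c fh : ℝ) (hα1 : 1 < α) (hα2 : α < 3/2)
    (hc : 0 < c) (hc1 : 1 ≤ Real.sqrt (c * (2:ℝ)^((2:ℝ) - α)))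
    (hβ : 0 < β) (hfh : 0 < fh) :
    Filter.liminf (fun N => fG α β fh N) Filter.atTop ≥
      1 - (1/c) * (2:ℝ)^α / ((2:ℝ)^(2:ℕ) - (2:ℝ)^α)
      - fh * (((2:ℝ) - α) * (2:ℝ)^((1:ℝ)/2 + α) / ((2:ℝ)^((3:ℝ)/2) - (2:ℝ)^α)^2 * Real.log 2
          + (2:ℝ)^α / ((2:ℝ)^((3:ℝ)/2) - (2:ℝ)^α)
            * Real.log (2 * Real.sqrt c * (1 + Real.sqrt (2 * Real.pi * Real.exp 1))))
      - (1/β) * ((2:ℝ)^α / ((2:ℝ)^(2:ℕ) - (2:ℝ)^α) * Real.log (2 * Real.sqrt c)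
          + ((2:ℝ) - α) * (2:ℝ)^(1 + α) / ((2:ℝ)^(2:ℕ) - (2:ℝ)^α)^2 * Real.log 2) := by
  have hsum := aux_series α β c fh hα1 hα2 hc hβ
  have hterm := aux_term α β c fh hα2 hc hc1 hβ hfh
  have hN : ∀ N, 1 - ∑ p ∈ Finset.range N, seriesTerm α β fh c (p+1) ≤ fG α β fh N := by
    intro N
    induction N with
    | zero => simp [aux_fG_zero]
    | succ N ih =>
      rw [Finset.sum_range_succ]
      have := (hterm N).2
      linarith
  refine le_liminf_of_le ?_ ?_
  · refine IsBoundedUnder.isCoboundedUnder_ge ⟨1, ?_⟩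
    rw [Filter.eventually_map]
    exact Eventually.of_forall fun N => aux_fG_le α β fh N
  · refine Eventually.of_forall fun N => ?_
    have h1 := sum_le_hasSum (Finset.range N) (fun p _ => (hterm p).1) hsum
    have h2 := hN N
    linarith

end
end

section
/- Fix α with 1 < α < 3/2, c > 0 with 1 ≤ (c·2^{2−α})^{1/2}, β > 0, and h > 0, and let the random fields be i.i.d. symmetric Bernoulli (P(h_i = 1) = P(h_i = −1) = 1/2). Then the long-range order parameter satisfies m² ≥ 1 − (1/c)·2^α/(2² − 2^α) − h·[ (2−α)·2^{1/2+α}/(2^{3/2} − 2^α)² · log 2 + 2^α/(2^{3/2} − 2^α) · log(2·c^{1/2}·(1 + √(2πe))) ] − (1/β)·[ 2^α/(2² − 2^α) · log(2·c^{1/2}) + (2−α)·2^{1+α}/(2² − 2^α)² · log 2 ]. -/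
open MeasureTheory ProbabilityTheory Filter
open scoped Classical

noncomputable section

lemma aux_cosh (a b : ℝ) : (Real.exp a + Real.exp b) / 2 ≤ Real.exp ((a+b)/2 + (a-b)^2/8) := by
  have h := Real.cosh_le_exp_half_sq ((a-b)/2)
  have e : (Real.exp a + Real.exp b) / 2 = Real.exp ((a+b)/2) * Real.cosh ((a-b)/2) := by
    rw [Real.cosh_eq, mul_div_assoc', mul_add, ← Real.exp_add, ← Real.exp_add]
    ring_nf
  rw [e, Real.exp_add]
  apply mul_le_mul_of_nonneg_left _ (Real.exp_pos _).le
  refine h.trans (le_of_eq ?_)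
  ring_nf

lemma subgauss (n : ℕ) (K : ℝ) (F : (Fin n → Bool) → ℝ)
    (hF : ∀ a b, F a - F b ≤ K * ∑ i, (if a i = b i then (0:ℝ) else 2)) :
    ∑ a, Real.exp (F a) ≤ 2^n * Real.exp ((2^n)⁻¹ * ∑ a, F a + n * K^2/2) := by
  induction n with
  | zero => simp
  | succ n ih =>
    have hsum : ∀ f : (Fin (n+1) → Bool) → ℝ,
        ∑ a, f a = ∑ a : Fin n → Bool, (f (Fin.cons true a) + f (Fin.cons false a)) := by
      intro f
      rw [← (Fin.consEquiv (fun _ : Fin (n+1) => Bool)).sum_comp, Fintype.sum_prod_type]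
      simp [Finset.sum_add_distrib, Fin.consEquiv]
    have key := ih (fun a => (F (Fin.cons true a) + F (Fin.cons false a))/2) (by
      intro a b
      have h1 := hF (Fin.cons true a) (Fin.cons true b)
      have h2 := hF (Fin.cons false a) (Fin.cons false b)
      simp only [Fin.sum_univ_succ, Fin.cons_zero, Fin.cons_succ, if_true, zero_add] at h1 h2
      linarith)
    rw [hsum]
    have hd : ∀ a : Fin n → Bool, (F (Fin.cons true a) - F (Fin.cons false a))^2 ≤ 4*K^2 := by
      intro a
      have h1 := hF (Fin.cons true a) (Fin.cons false a)
      have h2 := hF (Fin.cons false a) (Fin.cons true a)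
      simp [Fin.sum_univ_succ] at h1 h2
      nlinarith
    calc ∑ a : Fin n → Bool, (Real.exp (F (Fin.cons true a)) + Real.exp (F (Fin.cons false a)))
        ≤ ∑ a : Fin n → Bool, 2 * Real.exp (K^2/2) * Real.exp ((F (Fin.cons true a) + F (Fin.cons false a))/2) := by
          apply Finset.sum_le_sum
          intro a _
          have h := aux_cosh (F (Fin.cons true a)) (F (Fin.cons false a))
          have h3 : Real.exp ((F (Fin.cons true a) + F (Fin.cons false a))/2 + (F (Fin.cons true a) - F (Fin.cons false a))^2/8) ≤ Real.exp (K^2/2 + (F (Fin.cons true a) + F (Fin.cons false a))/2) := by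
            apply Real.exp_le_exp.mpr
            have := hd a
            linarith
          rw [Real.exp_add (K^2/2)] at h3
          linarith
      _ ≤ _ := by
          rw [← Finset.mul_sum]
          refine (mul_le_mul_of_nonneg_left key (by positivity)).trans (le_of_eq ?_)
          rw [hsum, ← Finset.sum_div]
          have : (((2:ℝ) ^ (n + 1))⁻¹ * ∑ i : Fin n → Bool, (F (Fin.cons true i) + F (Fin.cons false i)) + ((n+1:ℕ):ℝ) * K ^ 2 / 2)
             = K^2/2 + ((2 ^ n)⁻¹ * ((∑ i : Fin n → Bool, (F (Fin.cons true i) + F (Fin.cons false i))) / 2) + n * K ^ 2 / 2) := by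
            push_cast
            rw [pow_succ, mul_inv]
            ring
          rw [this, Real.exp_add (K^2/2)]
          ring

lemma subgauss2 (n : ℕ) (K : ℝ) (F : (Fin n → Bool) → ℝ)
    (hF : ∀ a b, F a - F b ≤ K * ∑ i, (if a i = b i then (0:ℝ) else 2)) :
    ∑ a, ∑ b, Real.exp (F a - F b) ≤ (2^n)^2 * Real.exp (n * K^2) := by
  have h1 := subgauss n K F hF
  have h2 := subgauss n K (fun a => - F a) (by
    intro a b
    have := hF b a
    simp only [eq_comm] at this ⊢
    linarith)
  have e : ∑ a, ∑ b, Real.exp (F a - F b) = (∑ a, Real.exp (F a)) * ∑ b, Real.exp (- F b) := by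
    rw [Finset.sum_mul_sum]
    simp only [← Real.exp_add, sub_eq_add_neg]
  rw [e]
  refine (mul_le_mul h1 h2 (by positivity) (by positivity)).trans (le_of_eq ?_)
  rw [mul_mul_mul_comm, ← Real.exp_add, Finset.sum_neg_distrib, ← sq]
  congr 2
  ring

/-- Jensen for log-exp -/
lemma log_jensen {X : Type*} [Fintype X] [Nonempty X] (w F : X → ℝ) (hw : ∀ x, 0 < w x) :
    (∑ x, F x * w x) / (∑ x, w x) ≤ Real.log (∑ x, w x * Real.exp (F x)) - Real.log (∑ x, w x) := by
  have hZ : 0 < ∑ x, w x := Finset.sum_pos (fun x _ => hw x) Finset.univ_nonempty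
  have hZ2 : 0 < ∑ x, w x * Real.exp (F x) :=
    Finset.sum_pos (fun x _ => mul_pos (hw x) (Real.exp_pos _)) Finset.univ_nonempty
  set m := (∑ x, F x * w x) / (∑ x, w x) with hm
  have h : Real.exp m * (∑ x, w x) ≤ ∑ x, w x * Real.exp (F x) := by
    have h1 : ∀ x, w x * (Real.exp m * (1 + (F x - m))) ≤ w x * Real.exp (F x) := by
      intro x
      apply mul_le_mul_of_nonneg_left _ (hw x).le
      have := Real.add_one_le_exp (F x - m)
      calc _ ≤ Real.exp m * Real.exp (F x - m) := by
            apply mul_le_mul_of_nonneg_left _ (Real.exp_pos _).le; linarith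
        _ = _ := by rw [← Real.exp_add]; ring_nf
    have h2 := Finset.sum_le_sum (fun x (_ : x ∈ Finset.univ) => h1 x)
    refine le_trans (le_of_eq ?_) h2
    have e : ∀ x, w x * (Real.exp m * (1 + (F x - m))) = Real.exp m * (1-m) * w x + Real.exp m * (F x * w x) := by
      intro x; ring
    simp only [e, Finset.sum_add_distrib, ← Finset.mul_sum]
    have : ∑ x, F x * w x = m * ∑ x, w x := by rw [hm]; field_simp
    rw [this]; ring
  have h3 := Real.log_le_log (by positivity) h
  rw [Real.log_mul (Real.exp_pos _).ne' hZ.ne', Real.log_exp] at h3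
  linarith

lemma pair_lower {X : Type*} [Fintype X] [Nonempty X] (w1 w2 S : X → ℝ) (hw1 : ∀ x, 0 < w1 x)
    (hw2 : ∀ x, 0 < w2 x) (v δ L r : ℝ) (hv : 0 ≤ v) (K : X → ℕ)
    (hδ : ∀ x y, K x = K y → (S x - S y)^2 ≤ δ^2) (hr : 0 < r)
    (hcard : ((Finset.univ.image K).card : ℝ) ≤ r)
    (hL : ∀ k ∈ Finset.univ.image K, 
      Real.log (∑ x with K x = k, w1 x * Real.exp (2 * v * S x^2)) -
       Real.log (∑ x with K x = k, w2 x * Real.exp (2 * v * S x^2)) ≤ L) :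
    2 * Real.log (∑ x, w1 x * Real.exp (2*v*S x^2)) - Real.log (∑ x, w1 x) - Real.log (∑ x, w2 x)
      - v * δ^2 - L - Real.log r ≤ 
    v * ((∑ p : X × X, (S p.1 + S p.2)^2 * (w1 p.1 * w2 p.2 * Real.exp (v * (S p.1 + S p.2)^2))) /
      ∑ p : X × X, (w1 p.1 * w2 p.2 * Real.exp (v * (S p.1 + S p.2)^2))) := by
  set ω1 : X → ℝ := fun x => w1 x * Real.exp (2*v*S x^2) with hω1
  set ω2 : X → ℝ := fun x => w2 x * Real.exp (2*v*S x^2) with hω2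
  have p1 : ∀ x, 0 < ω1 x := fun x => mul_pos (hw1 x) (Real.exp_pos _)
  have p2 : ∀ x, 0 < ω2 x := fun x => mul_pos (hw2 x) (Real.exp_pos _)
  set T := Finset.univ.image K with hT
  set Z : ℝ := ∑ p : X × X, (w1 p.1 * w2 p.2 * Real.exp (v * (S p.1 + S p.2)^2)) with hZ
  have hZpos : 0 < Z := Finset.sum_pos (fun p _ => mul_pos (mul_pos (hw1 _) (hw2 _)) (Real.exp_pos _)) Finset.univ_nonempty
  have s1 : 0 < ∑ x, w1 x := Finset.sum_pos (fun x _ => hw1 x) Finset.univ_nonempty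
  have s2 : 0 < ∑ x, w2 x := Finset.sum_pos (fun x _ => hw2 x) Finset.univ_nonempty
  have sW : 0 < ∑ x, ω1 x := Finset.sum_pos (fun x _ => p1 x) Finset.univ_nonempty
  have hA : Real.log Z - Real.log (∑ x, w1 x) - Real.log (∑ x, w2 x) ≤
      v * ((∑ p : X × X, (S p.1 + S p.2)^2 * (w1 p.1 * w2 p.2 * Real.exp (v * (S p.1 + S p.2)^2))) / Z) := by
    have h := log_jensen (fun p : X × X => w1 p.1 * w2 p.2 * Real.exp (v * (S p.1 + S p.2)^2))
      (fun p => - (v * (S p.1 + S p.2)^2)) (fun p => mul_pos (mul_pos (hw1 _) (hw2 _)) (Real.exp_pos _))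
    have e1 : ∑ p : X × X, w1 p.1 * w2 p.2 * Real.exp (v * (S p.1 + S p.2)^2) * Real.exp (- (v * (S p.1 + S p.2)^2))
        = (∑ x, w1 x) * ∑ x, w2 x := by
      rw [Finset.sum_mul_sum, Fintype.sum_prod_type]
      simp only [mul_assoc, ← Real.exp_add, add_neg_cancel, Real.exp_zero, mul_one]
    have e2 : ∑ p : X × X, -(v * (S p.1 + S p.2)^2) * (w1 p.1 * w2 p.2 * Real.exp (v * (S p.1 + S p.2)^2))
       = - (v * ∑ p : X × X, (S p.1 + S p.2)^2 * (w1 p.1 * w2 p.2 * Real.exp (v * (S p.1 + S p.2)^2))) := by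
      rw [Finset.mul_sum, ← Finset.sum_neg_distrib]
      apply Finset.sum_congr rfl; intro p _; ring
    rw [e1, e2, ← hZ, Real.log_mul s1.ne' s2.ne', neg_div, mul_div_assoc] at h
    linarith
  -- B
  have hB : Real.exp (-(v*δ^2)) * (Real.exp (-L) * ((∑ x, ω1 x)^2 / r)) ≤ Z := by
    have hB1 : Real.exp (-(v*δ^2)) * ∑ k ∈ T, (∑ x with K x = k, ω1 x) * (∑ x with K x = k, ω2 x) ≤ Z := by
      have e : ∑ k ∈ T, (∑ x with K x = k, ω1 x) * (∑ x with K x = k, ω2 x)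
          = ∑ p : X × X, if K p.1 = K p.2 then ω1 p.1 * ω2 p.2 else 0 := by
        rw [Fintype.sum_prod_type, ← Finset.sum_fiberwise_of_maps_to (s := Finset.univ) (t := T) (g := K)
          (fun x _ => Finset.mem_image_of_mem _ (Finset.mem_univ x))]
        apply Finset.sum_congr rfl; intro k _
        rw [Finset.sum_mul]
        apply Finset.sum_congr rfl; intro x hx
        have hx2 := (Finset.mem_filter.mp hx).2
        rw [Finset.mul_sum, Finset.sum_filter]
        apply Finset.sum_congr rfl; intro y _
        simp only [hx2, eq_comm]
      rw [e, Finset.mul_sum, hZ]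
      apply Finset.sum_le_sum
      intro p _
      split_ifs with hp
      · have := mul_le_mul_of_nonneg_left (hδ _ _ hp) hv
        simp only [hω1, hω2]
        have e3 : Real.exp (-(v*δ^2)) * (w1 p.1 * Real.exp (2*v*S p.1^2) * (w2 p.2 * Real.exp (2*v*S p.2^2)))
          = w1 p.1 * w2 p.2 * Real.exp (-(v*δ^2) + (2*v*S p.1^2 + 2*v*S p.2^2)) := by
          rw [Real.exp_add, Real.exp_add]; ring
        rw [e3]
        apply mul_le_mul_of_nonneg_left _ (mul_pos (hw1 _) (hw2 _)).le
        apply Real.exp_le_exp.mpr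
        nlinarith
      · rw [mul_zero]; exact (mul_pos (mul_pos (hw1 _) (hw2 _)) (Real.exp_pos _)).le
    have hB2 : ∀ k ∈ T, Real.exp (-L) * (∑ x with K x = k, ω1 x)^2 ≤ (∑ x with K x = k, ω1 x) * (∑ x with K x = k, ω2 x) := by
      intro k hk
      have hne : (Finset.univ.filter (fun x => K x = k)).Nonempty := by
        obtain ⟨x, -, hx⟩ := Finset.mem_image.mp hk
        exact ⟨x, by simp [hx]⟩
      have q1 : 0 < ∑ x with K x = k, ω1 x := Finset.sum_pos (fun x _ => p1 x) hne
      have q2 : 0 < ∑ x with K x = k, ω2 x := Finset.sum_pos (fun x _ => p2 x) hne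
      have h := hL k hk
      have h4 : Real.exp (-L) * (∑ x with K x = k, ω1 x) ≤ ∑ x with K x = k, ω2 x := by
        rw [← Real.log_le_log_iff (by positivity) q2, Real.log_mul (Real.exp_pos _).ne' q1.ne', Real.log_exp]
        linarith
      nlinarith
    have hB3 : (∑ x, ω1 x)^2 / r ≤ ∑ k ∈ T, (∑ x with K x = k, ω1 x)^2 := by
      rw [div_le_iff₀ hr]
      rw [← Finset.sum_fiberwise_of_maps_to (s := Finset.univ) (t := T) (g := K)
          (fun x _ => Finset.mem_image_of_mem _ (Finset.mem_univ x)) ω1]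
      have := sq_sum_le_card_mul_sum_sq (s := T) (f := fun k => ∑ x with K x = k, ω1 x)
      refine this.trans ?_
      rw [mul_comm]
      exact mul_le_mul_of_nonneg_left hcard (Finset.sum_nonneg (fun _ _ => sq_nonneg _))
    refine le_trans ?_ hB1
    apply mul_le_mul_of_nonneg_left _ (Real.exp_pos _).le
    refine le_trans (mul_le_mul_of_nonneg_left hB3 (Real.exp_pos _).le) ?_
    rw [Finset.mul_sum]
    exact Finset.sum_le_sum hB2
  have hC := Real.log_le_log (by positivity) hB
  rw [Real.log_mul (by positivity) (by positivity), Real.log_mul (by positivity) (by positivity),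
    Real.log_div (by positivity) (by positivity), Real.log_pow, Real.log_exp, Real.log_exp] at hC
  push_cast at hC
  linarith

lemma step_abs {X Y : Type*} [Fintype X] [Nonempty X] [Fintype Y] [Nonempty Y] (w : Y → X → ℝ) (S : X → ℝ)
    (hw : ∀ a x, 0 < w a x) (v δ r t : ℝ) (hv : 0 ≤ v) (K : X → ℕ)
    (hδ : ∀ x y, K x = K y → (S x - S y)^2 ≤ δ^2) (hr : 0 < r) (ht : 0 < t)
    (hcard : ((Finset.univ.image K).card : ℝ) ≤ r)
    (hsub : ∀ k ∈ Finset.univ.image K, ∑ a, ∑ b,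
      Real.exp (t * Real.log (∑ x with K x = k, w a x * Real.exp (2 * v * S x^2)) -
       t * Real.log (∑ x with K x = k, w b x * Real.exp (2 * v * S x^2))) ≤
         (Fintype.card Y : ℝ)^2 * Real.exp (1/2)) :
    (Fintype.card Y : ℝ) * (4 * v * ∑ a, (∑ x, S x^2 * w a x) / ∑ x, w a x)
      - (Fintype.card Y : ℝ)^2 * (v * δ^2 + Real.log r + t⁻¹ * (Real.log r + 1/2)) ≤
    v * ∑ a, ∑ b, ((∑ p : X × X, (S p.1 + S p.2)^2 * (w a p.1 * w b p.2 * Real.exp (v * (S p.1 + S p.2)^2))) /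
      ∑ p : X × X, (w a p.1 * w b p.2 * Real.exp (v * (S p.1 + S p.2)^2))) := by
  set T := Finset.univ.image K with hT
  set U : ℕ → Y → ℝ := fun k a => Real.log (∑ x with K x = k, w a x * Real.exp (2 * v * S x^2)) with hU
  have hTne : T.Nonempty := Finset.univ_nonempty.image _
  set A : ℝ := r * Real.exp (1/2) with hA
  have hApos : 0 < A := by positivity
  have hlogA : Real.log A = Real.log r + 1/2 := by
    rw [hA, Real.log_mul hr.ne' (Real.exp_pos _).ne', Real.log_exp]
  set E : Y → Y → ℝ := fun a b => ∑ k ∈ T, Real.exp (t * U k a - t * U k b) with hE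
  set L : Y → Y → ℝ := fun a b => t⁻¹ * (E a b / A - 1 + Real.log A) with hLdef
  set W : Y → ℝ := fun a => Real.log (∑ x, w a x * Real.exp (2*v*S x^2)) with hW
  set Z : Y → ℝ := fun a => Real.log (∑ x, w a x) with hZ
  have hpt : ∀ a b, 2 * W a - Z a - Z b - v * δ^2 - L a b - Real.log r ≤ v * ((∑ p : X × X, (S p.1 + S p.2)^2 * (w a p.1 * w b p.2 * Real.exp (v * (S p.1 + S p.2)^2))) /
      ∑ p : X × X, (w a p.1 * w b p.2 * Real.exp (v * (S p.1 + S p.2)^2))) := by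
    intro a b
    apply pair_lower (w a) (w b) S (hw a) (hw b) v δ (L a b) r hv K hδ hr hcard
    intro k hk
    change U k a - U k b ≤ L a b
    have hEpos : 0 < E a b := Finset.sum_pos (fun _ _ => Real.exp_pos _) hTne
    have h1 : Real.exp (t * U k a - t * U k b) ≤ E a b :=
      Finset.single_le_sum (f := fun k => Real.exp (t * U k a - t * U k b)) (fun _ _ => (Real.exp_pos _).le) hk
    have h2 : t * U k a - t * U k b ≤ Real.log (E a b) := by
      rw [Real.le_log_iff_exp_le hEpos]; exact h1
    have h3 := Real.log_le_sub_one_of_pos (div_pos hEpos hApos)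
    rw [Real.log_div hEpos.ne' hApos.ne'] at h3
    simp only [hLdef]
    rw [inv_mul_eq_div, le_div_iff₀ ht]
    linarith
  have hjen : ∀ a, 2 * v * ((∑ x, S x^2 * w a x) / ∑ x, w a x) ≤ W a - Z a := by
    intro a
    have h := log_jensen (w a) (fun x => 2 * v * S x^2) (hw a)
    refine le_trans (le_of_eq ?_) h
    simp only [mul_assoc, ← Finset.mul_sum, mul_div_assoc]
  have hEsum : ∑ a, ∑ b, E a b ≤ (Fintype.card Y : ℝ)^2 * A := by
    have : ∑ a, ∑ b, E a b = ∑ k ∈ T, ∑ a, ∑ b, Real.exp (t * U k a - t * U k b) := by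
      rw [Finset.sum_comm]
      simp only [hE]
      rw [Finset.sum_comm]
      rw [Finset.sum_comm (s := T)]
      apply Finset.sum_congr rfl; intro a _
      rw [Finset.sum_comm]
    rw [this]
    refine (Finset.sum_le_sum hsub).trans ?_
    rw [Finset.sum_const, nsmul_eq_mul, hA]
    have : (0:ℝ) ≤ (Fintype.card Y : ℝ)^2 * Real.exp (1/2) := by positivity
    nlinarith
  have hsum := Finset.sum_le_sum (fun a (_ : a ∈ Finset.univ) => Finset.sum_le_sum (fun b (_ : b ∈ (Finset.univ : Finset Y)) => hpt a b))
  simp only [← Finset.mul_sum] at hsum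
  refine le_trans ?_ hsum
  have hJ := Finset.sum_le_sum (fun a (_ : a ∈ Finset.univ) => hjen a)
  rw [← Finset.mul_sum, Finset.sum_sub_distrib] at hJ
  simp only [Finset.sum_sub_distrib, Finset.sum_const, Finset.card_univ, nsmul_eq_mul, hLdef,
    ← Finset.mul_sum, Finset.sum_add_distrib, ← Finset.sum_div]
  set n : ℝ := (Fintype.card Y : ℝ)
  have hn : 0 ≤ n := Nat.cast_nonneg _
  have h5 := mul_le_mul_of_nonneg_left hJ hn
  have h6 : (∑ a, ∑ b, E a b) / A ≤ n^2 := by rw [div_le_iff₀ hApos]; exact hEsum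
  have h7 := mul_le_mul_of_nonneg_left h6 (inv_pos.mpr ht).le
  rw [hlogA]
  nlinarith

/-- splitting the index set in two halves -/
def halfE (N : ℕ) : Fin (2^N) ⊕ Fin (2^N) ≃ Fin (2^(N+1)) :=
  finSumFinEquiv.trans (finCongr (by rw [pow_succ]; omega))

/-- splitting a configuration in two halves -/
def cfgE (N : ℕ) (A : Type) : (Fin (2^(N+1)) → A) ≃ (Fin (2^N) → A) × (Fin (2^N) → A) :=
  (Equiv.arrowCongr (halfE N).symm (Equiv.refl A)).trans (Equiv.sumArrowEquivProdArrow _ _ _)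

lemma cfgE_fst (N : ℕ) (A : Type) (σ : Fin (2^(N+1)) → A) (i : Fin (2^N)) :
    (cfgE N A σ).1 i = σ (halfE N (Sum.inl i)) := rfl

lemma cfgE_snd (N : ℕ) (A : Type) (σ : Fin (2^(N+1)) → A) (i : Fin (2^N)) :
    (cfgE N A σ).2 i = σ (halfE N (Sum.inr i)) := rfl

lemma sum_half (N : ℕ) (f : Fin (2^(N+1)) → ℝ) :
    ∑ i, f i = ∑ i, f (halfE N (Sum.inl i)) + ∑ i, f (halfE N (Sum.inr i)) := by
  rw [← (halfE N).sum_comp, Fintype.sum_sum_type]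

lemma dysonH_succ (α : ℝ) (N : ℕ) (σ : Fin (2^(N+1)) → Bool) :
    dysonH α (N+1) σ = dysonH α N (cfgE N _ σ).1 + dysonH α N (cfgE N _ σ).2
      - (2:ℝ) ^ (-(α * ((N:ℝ)+1))) * (totalSpin N (cfgE N _ σ).1 + totalSpin N (cfgE N _ σ).2)^2 := by
  rw [dysonH]
  have e : ∑ i : Fin (2^(N+1)), ∑ j : Fin (2^(N+1)), spin (σ i) * spin (σ j) =
    (totalSpin N (cfgE N _ σ).1 + totalSpin N (cfgE N _ σ).2)^2 := by
    rw [← Finset.sum_mul_sum, ← sq, sum_half]; rfl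
  rw [e]
  rfl

lemma totalSpin_succ (N : ℕ) (σ : Fin (2^(N+1)) → Bool) :
    totalSpin (N+1) σ = totalSpin N (cfgE N _ σ).1 + totalSpin N (cfgE N _ σ).2 := by
  rw [totalSpin, sum_half]; rfl

/-- Gibbs weight for Boolean fields -/
def wt (α β fh : ℝ) (N : ℕ) (a x : Fin (2^N) → Bool) : ℝ :=
  Real.exp (-β * dysonHRF α fh N (fun i => spin (a i)) x)

lemma wt_succ (α β fh : ℝ) (N : ℕ) (a x : Fin (2^(N+1)) → Bool) :
    wt α β fh (N+1) a x = wt α β fh N (cfgE N _ a).1 (cfgE N _ x).1 * wt α β fh N (cfgE N _ a).2 (cfgE N _ x).2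
      * Real.exp ((β * (2:ℝ) ^ (-(α * ((N:ℝ)+1)))) * (totalSpin N (cfgE N _ x).1 + totalSpin N (cfgE N _ x).2)^2) := by
  unfold wt dysonHRF
  rw [dysonH_succ, sum_half, ← Real.exp_add, ← Real.exp_add]
  congr 1
  simp only [cfgE_fst, cfgE_snd]
  ring

lemma gibbs_wt (α β fh : ℝ) (N : ℕ) (a : Fin (2^N) → Bool) (F : (Fin (2^N) → Bool) → ℝ) :
    gibbs α β fh N (fun i => spin (a i)) F = (∑ x, F x * wt α β fh N a x) / ∑ x, wt α β fh N a x := rfl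

lemma gibbs_succ (α β fh : ℝ) (N : ℕ) (a : Fin (2^(N+1)) → Bool) :
    gibbs α β fh (N+1) (fun i => spin (a i)) (fun σ => (totalSpin (N+1) σ)^2) =
    (fun b c => (∑ p : (Fin (2^N) → Bool) × (Fin (2^N) → Bool), (totalSpin N p.1 + totalSpin N p.2)^2 *
      (wt α β fh N b p.1 * wt α β fh N c p.2 * 
        Real.exp ((β * (2:ℝ) ^ (-(α * ((N:ℝ)+1)))) * (totalSpin N p.1 + totalSpin N p.2)^2))) /
      ∑ p : (Fin (2^N) → Bool) × (Fin (2^N) → Bool), (wt α β fh N b p.1 * wt α β fh N c p.2 * 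
        Real.exp ((β * (2:ℝ) ^ (-(α * ((N:ℝ)+1)))) * (totalSpin N p.1 + totalSpin N p.2)^2))) 
      (cfgE N _ a).1 (cfgE N _ a).2 := by
  rw [gibbs_wt]
  simp only [wt_succ, totalSpin_succ]
  rw [← (cfgE N Bool).sum_comp, ← (cfgE N Bool).sum_comp]

lemma abs_totalSpin (N : ℕ) (σ : Fin (2^N) → Bool) : |totalSpin N σ| ≤ 2^N := by
  unfold totalSpin
  refine (Finset.abs_sum_le_sum_abs _ _).trans ?_
  have : ∀ b, |spin b| = 1 := by intro b; cases b <;> simp [spin]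
  simp [this]

lemma wt_lip (α β fh : ℝ) (hβ : 0 < β) (hfh : 0 < fh) (N : ℕ) (a b x : Fin (2^N) → Bool) :
    wt α β fh N a x ≤ Real.exp (β * fh * ∑ i, (if a i = b i then (0:ℝ) else 2)) * wt α β fh N b x := by
  unfold wt dysonHRF
  rw [← Real.exp_add]
  apply Real.exp_le_exp.mpr
  have h : ∑ i, spin (a i) * spin (x i) ≤ ∑ i, (if a i = b i then (0:ℝ) else 2) + ∑ i, spin (b i) * spin (x i) := by
    rw [← Finset.sum_add_distrib]
    apply Finset.sum_le_sum
    intro i _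
    rcases a i <;> rcases b i <;> rcases x i <;> simp [spin] <;> norm_num
  have := mul_le_mul_of_nonneg_left h (mul_pos hβ hfh).le
  linarith

lemma exists_block (r : ℕ) (hr : 1 ≤ r) (a : ℝ) (h0 : 0 ≤ a) (h1 : a ≤ r) :
    ∃ k : ℕ, k < r ∧ (k:ℝ) ≤ a ∧ a ≤ k + 1 := by
  by_cases h : ⌊a⌋₊ < r
  · exact ⟨⌊a⌋₊, h, Nat.floor_le h0, (Nat.lt_floor_add_one a).le⟩
  · push Not at h
    have h2 : (r:ℝ) ≤ a := (Nat.le_floor_iff h0).mp h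
    refine ⟨r-1, by omega, ?_, ?_⟩ <;> push_cast [Nat.cast_sub hr] <;> linarith

lemma step_conc (α β fh : ℝ) (hβ : 0 < β) (hfh : 0 < fh) (N r : ℕ) (hr : 1 ≤ r) :
    fB α β fh N - (1 / (β * bcoef α (N+1))) * (β * bcoef α (N+1) / r^2 + Real.log r
      + β * fh * (2:ℝ)^(((N+1:ℕ):ℝ)/2) * (Real.log r + 1/2)) ≤ fB α β fh (N+1) := by
  set κ : ℝ := (2:ℝ) ^ (-(α * ((N:ℝ)+1))) with hκ
  have hκpos : 0 < κ := by positivity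
  have hr0 : (0:ℝ) < r := by exact_mod_cast hr
  have hb : bcoef α (N+1) = κ * (2^(N+1))^2 := by
    rw [bcoef, hκ, ← pow_mul, ← Real.rpow_natCast, ← Real.rpow_add (by norm_num)]
    congr 1; push_cast; ring
  set q : ℝ := (2:ℝ)^(((N+1:ℕ):ℝ)/2) with hq
  have hqpos : 0 < q := by positivity
  have hq2 : q^2 = 2^(N+1) := by
    rw [hq, ← Real.rpow_natCast, ← Real.rpow_mul (by norm_num), ← Real.rpow_natCast]
    congr 1; push_cast; ring
  set t : ℝ := (β * fh * q)⁻¹ with ht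
  have htpos : 0 < t := by positivity
  have hM : (0:ℝ) < 2^N := by positivity
  have hblk : ∀ x : Fin (2^N) → Bool, ∃ k : ℕ, k < r ∧ (k:ℝ) ≤ (totalSpin N x + 2^N) * r / (2 * 2^N) ∧
      (totalSpin N x + 2^N) * r / (2 * 2^N) ≤ k + 1 := by
    intro x
    have := abs_le.mp (abs_totalSpin N x)
    apply exists_block r hr
    · apply div_nonneg (mul_nonneg (by linarith) hr0.le) (by positivity)
    · rw [div_le_iff₀ (by positivity), mul_comm]
      apply mul_le_mul_of_nonneg_left _ hr0.le; linarith
  choose K hK1 hK2 hK3 using hblk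
  have hstep := step_abs (wt α β fh N) (totalSpin N) (fun _ _ => Real.exp_pos _) (β * κ) (2^(N+1)/r) r t
    (by positivity) K (by
      intro x y hxy
      have a1 := hK2 x
      have a2 := hK3 x
      have b1 := hK2 y
      have b2 := hK3 y
      rw [hxy] at a1 a2
      have e : totalSpin N x - totalSpin N y = (2^(N+1)/r) * 
         ((totalSpin N x + 2^N) * r / (2 * 2^N) - (totalSpin N y + 2^N) * r / (2 * 2^N)) := by
        rw [pow_succ]; field_simp; ring
      rw [e, mul_pow]
      have : ((totalSpin N x + 2^N) * r / (2 * 2^N) - (totalSpin N y + 2^N) * r / (2 * 2^N))^2 ≤ 1 := by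
        rw [sq_le_one_iff_abs_le_one, abs_le]; constructor <;> linarith
      exact mul_le_of_le_one_right (sq_nonneg _) this) hr0 htpos (by
      have : Finset.univ.image K ⊆ Finset.range r := by
        intro k hk
        obtain ⟨x, -, rfl⟩ := Finset.mem_image.mp hk
        exact Finset.mem_range.mpr (hK1 x)
      have := Finset.card_le_card this
      rw [Finset.card_range] at this
      exact_mod_cast this) (by
      intro k hk
      have hne : (Finset.univ.filter (fun x => K x = k)).Nonempty := by
        obtain ⟨x, -, hx⟩ := Finset.mem_image.mp hk
        exact ⟨x, by simp [hx]⟩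
      have hpos : ∀ a, 0 < ∑ x with K x = k, wt α β fh N a x * Real.exp (2 * (β*κ) * totalSpin N x^2) :=
        fun a => Finset.sum_pos (fun x _ => mul_pos (Real.exp_pos _) (Real.exp_pos _)) hne
      have h := subgauss2 (2^N) (t * (β * fh)) (fun a => t * Real.log (∑ x with K x = k, wt α β fh N a x * Real.exp (2 * (β*κ) * totalSpin N x^2))) (by
        intro a b
        rw [← mul_sub, mul_assoc]
        apply mul_le_mul_of_nonneg_left _ htpos.le
        rw [sub_le_iff_le_add]
        have h1 : ∑ x with K x = k, wt α β fh N a x * Real.exp (2 * (β*κ) * totalSpin N x^2) ≤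
          Real.exp (β * fh * ∑ i, (if a i = b i then (0:ℝ) else 2)) * ∑ x with K x = k, wt α β fh N b x * Real.exp (2 * (β*κ) * totalSpin N x^2) := by
          rw [Finset.mul_sum]
          apply Finset.sum_le_sum
          intro x _
          rw [← mul_assoc (Real.exp (β * fh * _))]
          exact mul_le_mul_of_nonneg_right (wt_lip α β fh hβ hfh N a b x) (Real.exp_pos _).le
        have h2 := Real.log_le_log (hpos a) h1
        rwa [Real.log_mul (Real.exp_pos _).ne' (hpos b).ne', Real.log_exp] at h2)
      refine h.trans (le_of_eq ?_)
      have e1 : ((2^N : ℕ) : ℝ) * (t * (β * fh))^2 = 1/2 := by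
        have : t * (β * fh) = q⁻¹ := by rw [ht]; field_simp
        rw [this, inv_pow, hq2, pow_succ]; push_cast; field_simp
      rw [e1]
      simp)
  have hcardY : (Fintype.card (Fin (2^N) → Bool) : ℝ) = 2^(2^N) := by simp
  rw [hcardY] at hstep
  have hfN : fB α β fh N = ((2:ℝ)^(2*N))⁻¹ * (((2:ℝ)^(2^N))⁻¹ * ∑ a, (∑ x, totalSpin N x^2 * wt α β fh N a x) / ∑ x, wt α β fh N a x) := rfl
  have hfN1 : fB α β fh (N+1) = ((2:ℝ)^(2*(N+1)))⁻¹ * (((2:ℝ)^(2^(N+1)))⁻¹ * 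
     ∑ b, ∑ c, ((∑ p : (Fin (2^N) → Bool) × (Fin (2^N) → Bool), (totalSpin N p.1 + totalSpin N p.2)^2 *
      (wt α β fh N b p.1 * wt α β fh N c p.2 * 
        Real.exp ((β * κ) * (totalSpin N p.1 + totalSpin N p.2)^2))) /
      ∑ p : (Fin (2^N) → Bool) × (Fin (2^N) → Bool), (wt α β fh N b p.1 * wt α β fh N c p.2 * 
        Real.exp ((β * κ) * (totalSpin N p.1 + totalSpin N p.2)^2)))) := by
    unfold fB bernoulliExp
    simp only [gibbs_succ]
    rw [← Fintype.sum_prod_type', ← (cfgE N Bool).sum_comp]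
  rw [hfN, hfN1]
  set G := ∑ b, ∑ c, ((∑ p : (Fin (2^N) → Bool) × (Fin (2^N) → Bool), (totalSpin N p.1 + totalSpin N p.2)^2 *
      (wt α β fh N b p.1 * wt α β fh N c p.2 * 
        Real.exp ((β * κ) * (totalSpin N p.1 + totalSpin N p.2)^2))) /
      ∑ p : (Fin (2^N) → Bool) × (Fin (2^N) → Bool), (wt α β fh N b p.1 * wt α β fh N c p.2 * 
        Real.exp ((β * κ) * (totalSpin N p.1 + totalSpin N p.2)^2)))
  set g := ∑ a, (∑ x, totalSpin N x^2 * wt α β fh N a x) / ∑ x, wt α β fh N a x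
  rw [hb]
  have hti : t⁻¹ = β * fh * q := by rw [ht, inv_inv]
  rw [hti] at hstep
  set n : ℝ := 2^(2^N) with hn
  have hnpos : 0 < n := by positivity
  have e2 : (2:ℝ)^(2^(N+1)) = n^2 := by rw [hn, ← pow_mul, pow_succ]
  have e3 : (2:ℝ)^(2*N) = (2^N)^2 := by rw [← pow_mul, mul_comm]
  have e4 : (2:ℝ)^(2*(N+1)) = (2^(N+1))^2 := by rw [← pow_mul, mul_comm]
  rw [e2, e3, e4]
  set X := Real.log r
  have hfac : (0:ℝ) ≤ (β * κ * (2^(N+1))^2 * n^2)⁻¹ := by positivity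
  have := mul_le_mul_of_nonneg_left hstep hfac
  refine le_trans (le_of_eq ?_) (this.trans (le_of_eq ?_))
  · rw [pow_succ]; field_simp; try ring
  · field_simp

lemma seriesTerm_step (α β c fh : ℝ) (hα2 : α < 3/2)
    (hc : 0 < c) (hc1 : 1 ≤ Real.sqrt (c * (2:ℝ)^((2:ℝ) - α)))
    (hβ : 0 < β) (hfh : 0 < fh) (N : ℕ) :
    fB α β fh N - seriesTerm α β fh c (N+1) ≤ fB α β fh (N+1) := by
  set b := bcoef α (N+1) with hb
  have hbpos : 0 < b := by rw [hb, bcoef]; positivity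
  set s := Real.sqrt (c * b) with hs
  have hs1 : 1 ≤ s := by
    refine hc1.trans (Real.sqrt_le_sqrt (mul_le_mul_of_nonneg_left ?_ hc.le))
    rw [hb, bcoef]
    apply Real.rpow_le_rpow_of_exponent_le (by norm_num)
    push_cast
    nlinarith [Nat.cast_nonneg (α := ℝ) N]
  set r := ⌈s⌉₊ with hrdef
  have hrs : s ≤ r := Nat.le_ceil s
  have hr1 : (1:ℝ) ≤ r := hs1.trans hrs
  have hr2 : (r:ℝ) ≤ 2 * s := by
    have := Nat.ceil_lt_add_one (by linarith : 0 ≤ s)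
    linarith
  have hr : 1 ≤ r := by exact_mod_cast hr1
  refine le_trans (sub_le_sub_left ?_ _) (step_conc α β fh hβ hfh N r hr)
  unfold seriesTerm
  rw [← hb, ← hs]
  have hlog : Real.log r ≤ Real.log (2 * s) := Real.log_le_log (by linarith) hr2
  have hss : s^2 = c * b := Real.sq_sqrt (by positivity)
  have h1 : β * b / r^2 ≤ β / c := by
    rw [div_le_div_iff₀ (by positivity) hc]
    have : c * b ≤ (r:ℝ)^2 := by rw [← hss]; exact pow_le_pow_left₀ (by linarith) hrs 2
    nlinarith
  set D := 1 + Real.sqrt (2 * Real.pi * Real.exp 1) with hD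
  have hD0 : 0 < D := by positivity
  have h2 : (1:ℝ)/2 ≤ Real.log D := by
    rw [Real.le_log_iff_exp_le hD0, Real.exp_half]
    have : Real.sqrt (Real.exp 1) ≤ Real.sqrt (2 * Real.pi * Real.exp 1) := by
      apply Real.sqrt_le_sqrt
      have := Real.pi_gt_three
      nlinarith [Real.exp_pos 1]
    linarith
  have h3 : Real.log r + 1/2 ≤ Real.log (2 * s * D) := by
    rw [Real.log_mul (by positivity) hD0.ne']; linarith
  gcongr

lemma hasSum_aux (x : ℝ) (h0 : 0 ≤ x) (h1 : x < 1) (A B : ℝ) :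
    HasSum (fun p : ℕ => x^(p+1) * (A + ((p+1:ℕ):ℝ) * B)) (x/(1-x) * A + x/(1-x)^2 * B) := by
  have g1 : HasSum (fun p : ℕ => x^(p+1)) (x/(1-x)) := by
    have := (hasSum_geometric_of_lt_one h0 h1).mul_left x
    simpa [pow_succ', div_eq_mul_inv] using this
  have g2 : HasSum (fun p : ℕ => ((p+1:ℕ):ℝ) * x^(p+1)) (x/(1-x)^2) := by
    have := hasSum_coe_mul_geometric_of_norm_lt_one (r := x) (by rwa [Real.norm_of_nonneg h0])
    have := (hasSum_nat_add_iff' 1).mpr this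
    simpa using this
  have := (g1.mul_right A).add (g2.mul_right B)
  have e : (fun p : ℕ => x^(p+1) * (A + ((p+1:ℕ):ℝ) * B)) = fun p : ℕ => x^(p+1) * A + ((p+1:ℕ):ℝ) * x^(p+1) * B := by
    funext p; ring
  rw [e]; exact this

lemma seriesTerm_eq (α β c fh : ℝ) (hc : 0 < c) (hβ : 0 < β) (p : ℕ) :
    seriesTerm α β fh c p = ((2:ℝ)^(α-2))^p * ((1/c + 1/β * Real.log (2 * Real.sqrt c)) + p * (1/β * ((2-α)/2 * Real.log 2)))
      + ((2:ℝ)^(α-3/2))^p * (fh * Real.log (2 * Real.sqrt c * (1 + Real.sqrt (2*Real.pi*Real.exp 1))) + p * (fh * ((2-α)/2 * Real.log 2))) := by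
  set D := 1 + Real.sqrt (2 * Real.pi * Real.exp 1) with hD
  have hD0 : 0 < D := by positivity
  have hbpos : 0 < bcoef α p := by rw [bcoef]; positivity
  have hx : ((2:ℝ)^(α-2))^p = (bcoef α p)⁻¹ := by
    rw [bcoef, ← Real.rpow_natCast, ← Real.rpow_mul (by norm_num), ← Real.rpow_neg (by norm_num)]
    congr 1; ring
  have hy : ((2:ℝ)^(α-3/2))^p = (bcoef α p)⁻¹ * (2:ℝ)^((p:ℝ)/2) := by
    rw [bcoef, ← Real.rpow_natCast, ← Real.rpow_mul (by norm_num), ← Real.rpow_neg (by norm_num), ← Real.rpow_add (by norm_num)]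
    congr 1; ring
  have hl : Real.log (2 * Real.sqrt (c * bcoef α p)) = Real.log (2 * Real.sqrt c) + p * ((2-α)/2 * Real.log 2) := by
    rw [Real.sqrt_mul hc.le, ← mul_assoc, Real.log_mul (by positivity) (by positivity), Real.log_sqrt hbpos.le]
    conv_lhs => rw [bcoef, Real.log_rpow (by norm_num)]
    ring
  have hl2 : Real.log (2 * Real.sqrt (c * bcoef α p) * D) = Real.log (2 * Real.sqrt c * D) + p * ((2-α)/2 * Real.log 2) := by
    rw [Real.log_mul (by positivity) hD0.ne', hl, Real.log_mul (by positivity) hD0.ne']; ring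
  unfold seriesTerm
  rw [← hD, hl, hl2, hx, hy]
  field_simp
  try ring

lemma fB_zero (α β fh : ℝ) : fB α β fh 0 = 1 := by
  have h : ∀ x, totalSpin 0 x ^ 2 = 1 := by
    intro x
    have : totalSpin 0 x = spin (x 0) := by
      unfold totalSpin; exact Fin.sum_univ_one _
    rw [this]; cases x 0 <;> simp [spin]
  have hg : ∀ a, gibbs α β fh 0 a (fun σ => (totalSpin 0 σ)^2) = 1 := by
    intro a
    unfold gibbs
    simp only [h, one_mul]
    exact div_self (Finset.sum_pos (fun _ _ => Real.exp_pos _) Finset.univ_nonempty).ne'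
  unfold fB bernoulliExp
  simp only [hg]
  simp

lemma fB_le_one (α β fh : ℝ) (N : ℕ) : fB α β fh N ≤ 1 := by
  have hg : ∀ a, gibbs α β fh N a (fun σ => (totalSpin N σ)^2) ≤ 2^(2*N) := by
    intro a
    unfold gibbs
    rw [div_le_iff₀ (Finset.sum_pos (fun _ _ => Real.exp_pos _) Finset.univ_nonempty), Finset.mul_sum]
    apply Finset.sum_le_sum
    intro σ _
    apply mul_le_mul_of_nonneg_right _ (Real.exp_pos _).le
    have := abs_totalSpin N σ
    change totalSpin N σ ^ 2 ≤ 2^(2*N)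
    rw [← sq_abs, mul_comm 2 N, pow_mul]
    exact pow_le_pow_left₀ (abs_nonneg _) this 2
  unfold fB bernoulliExp
  have : ∑ ε : Fin (2^N) → Bool, gibbs α β fh N (fun i => spin (ε i)) (fun σ => (totalSpin N σ)^2) ≤ 2^(2^N) * 2^(2*N) := by
    refine (Finset.sum_le_sum (fun ε _ => hg _)).trans (le_of_eq ?_)
    simp
  calc _ ≤ ((2:ℝ)^(2*N))⁻¹ * (((2:ℝ)^(2^N))⁻¹ * (2^(2^N) * 2^(2*N))) := by gcongr
    _ = 1 := by field_simp

/-- Theorem 1 of the paper (bernoulli random fields): lower bound on the long-range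
order parameter `m² = liminf_N f_N` for `1 < α < 3/2`. -/
theorem rfim_dyson_lro_bound_bernoulli (α β c fh : ℝ) (hα1 : 1 < α) (hα2 : α < 3/2)
    (hc : 0 < c) (hc1 : 1 ≤ Real.sqrt (c * (2:ℝ)^((2:ℝ) - α)))
    (hβ : 0 < β) (hfh : 0 < fh) :
    Filter.liminf (fun N => fB α β fh N) Filter.atTop ≥
      1 - (1/c) * (2:ℝ)^α / ((2:ℝ)^(2:ℕ) - (2:ℝ)^α)
      - fh * (((2:ℝ) - α) * (2:ℝ)^((1:ℝ)/2 + α) / ((2:ℝ)^((3:ℝ)/2) - (2:ℝ)^α)^2 * Real.log 2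
          + (2:ℝ)^α / ((2:ℝ)^((3:ℝ)/2) - (2:ℝ)^α)
            * Real.log (2 * Real.sqrt c * (1 + Real.sqrt (2 * Real.pi * Real.exp 1))))
      - (1/β) * ((2:ℝ)^α / ((2:ℝ)^(2:ℕ) - (2:ℝ)^α) * Real.log (2 * Real.sqrt c)
          + ((2:ℝ) - α) * (2:ℝ)^(1 + α) / ((2:ℝ)^(2:ℕ) - (2:ℝ)^α)^2 * Real.log 2) := by
  set x : ℝ := (2:ℝ)^(α-2) with hx
  set y : ℝ := (2:ℝ)^(α-3/2) with hy
  have hx0 : 0 < x := by positivity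
  have hy0 : 0 < y := by positivity
  have hx1 : x < 1 := Real.rpow_lt_one_of_one_lt_of_neg (by norm_num) (by linarith)
  have hy1 : y < 1 := Real.rpow_lt_one_of_one_lt_of_neg (by norm_num) (by linarith)
  have hsum := (hasSum_aux x hx0.le hx1 (1/c + 1/β * Real.log (2 * Real.sqrt c)) (1/β * ((2-α)/2 * Real.log 2))).add
    (hasSum_aux y hy0.le hy1 (fh * Real.log (2 * Real.sqrt c * (1 + Real.sqrt (2*Real.pi*Real.exp 1)))) (fh * ((2-α)/2 * Real.log 2)))
  set TT := x/(1-x) * (1/c + 1/β * Real.log (2 * Real.sqrt c)) + x/(1-x)^2 * (1/β * ((2-α)/2 * Real.log 2)) +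
    (y/(1-y) * (fh * Real.log (2 * Real.sqrt c * (1 + Real.sqrt (2*Real.pi*Real.exp 1)))) + y/(1-y)^2 * (fh * ((2-α)/2 * Real.log 2))) with hTT
  have hsum2 : HasSum (fun p : ℕ => seriesTerm α β fh c (p+1)) TT := by
    convert hsum using 2 with p
    rw [seriesTerm_eq α β c fh hc hβ]
  have hlow : ∀ N, 1 - ∑ p ∈ Finset.range N, seriesTerm α β fh c (p+1) ≤ fB α β fh N := by
    intro N
    induction N with
    | zero => simp [fB_zero]
    | succ N ih =>
      have := seriesTerm_step α β c fh hα2 hc hc1 hβ hfh N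
      rw [Finset.sum_range_succ]
      linarith
  have htend : Tendsto (fun N => 1 - ∑ p ∈ Finset.range N, seriesTerm α β fh c (p+1)) atTop (nhds (1 - TT)) :=
    tendsto_const_nhds.sub hsum2.tendsto_sum_nat
  have hlim : 1 - TT ≤ liminf (fun N => fB α β fh N) atTop := by
    rw [← htend.liminf_eq]
    exact liminf_le_liminf (Eventually.of_forall hlow) htend.isBoundedUnder_ge
      (isBoundedUnder_of ⟨1, fun N => fB_le_one α β fh N⟩ : IsBoundedUnder (· ≤ ·) atTop (fun N => fB α β fh N)).isCoboundedUnder_ge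
  refine ge_iff_le.mpr (le_trans (le_of_eq ?_) hlim)
  set P : ℝ := (2:ℝ)^α with hP
  have hPpos : 0 < P := by positivity
  have ex : x = P / 4 := by
    rw [hx, Real.rpow_sub (by norm_num), hP]; norm_num
  set R : ℝ := (2:ℝ)^((3:ℝ)/2) with hR
  have hRpos : 0 < R := by positivity
  have ey : y = P / R := by
    rw [hy, Real.rpow_sub (by norm_num)]
  have hP4 : P < 4 := by rw [ex] at hx1; linarith
  have hPR : P < R := by rw [ey, div_lt_one hRpos] at hy1; exact hy1
  have hR2 : R = 2 * (2:ℝ)^((1:ℝ)/2) := by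
    rw [hR, show (3:ℝ)/2 = 1 + 1/2 by norm_num, Real.rpow_add (by norm_num), Real.rpow_one]
  have e1 : (2:ℝ)^((1:ℝ)/2 + α) = R / 2 * P := by
    rw [Real.rpow_add (by norm_num), hR2]; ring
  have e2 : (2:ℝ)^(1 + α) = 2 * P := by
    rw [Real.rpow_add (by norm_num), Real.rpow_one]
  have f1 : x/(1-x) = P/(4-P) := by
    rw [ex]; have : 4 - P ≠ 0 := by linarith
    have : 1 - P/4 ≠ 0 := by intro h; linarith
    field_simp
  have f2 : x/(1-x)^2 = 4*P/(4-P)^2 := by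
    rw [ex]; have : 4 - P ≠ 0 := by linarith
    have h2 : 1 - P/4 = (4-P)/4 := by ring
    rw [h2]; field_simp
  have hRP : R - P ≠ 0 := by linarith
  have h3 : 1 - P/R = (R-P)/R := by field_simp
  have f3 : y/(1-y) = P/(R-P) := by
    rw [ey, h3]; field_simp
  have f4 : y/(1-y)^2 = R*P/(R-P)^2 := by
    rw [ey, h3]; field_simp
  rw [hTT, f1, f2, f3, f4, e1, e2]
  norm_num
  ring

end
end
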